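/- arXiv:1805.04480 — 2 statements merged into one kernel-verified Lean document; each statement's English description precedes it below -/
import Mathlib

section
/- Let ξ₁, ξ₂ be real numbers such that {1, ξ₁, ξ₂} is linearly independent over ℚ. Then 0 ≤ φ̲₃ ≤ φ̄₃ ≤ 1, φ̲₃ + φ̲₃·φ̄₁ + φ̄₁ = 0, 2φ̲₁ + φ̄₃ ≤ −φ̲₃(3 + φ̲₁ + 2φ̄₃), and 2φ̄₃ + φ̲₁ ≥ −φ̄₁(3 + φ̄₃ + 2φ̲₁). -/
open Filter Pointwise

/-- The lattice `Λ = {(x, ξ₁x - y₁, ξ₂x - y₂) : x, y₁, y₂ ∈ ℤ} ⊆ ℝ³`. -/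
def LatticeSet (ξ₁ ξ₂ : ℝ) : Set (Fin 3 → ℝ) :=
  {p | ∃ x y₁ y₂ : ℤ, p 0 = (x : ℝ) ∧ p 1 = ξ₁ * x - y₁ ∧ p 2 = ξ₂ * x - y₂}

/-- The box `K(q) = {(z₀,z₁,z₂) : |z₀| ≤ e^{2q}, |z₁| ≤ e^{-q}, |z₂| ≤ e^{-q}}`. -/
def Box (q : ℝ) : Set (Fin 3 → ℝ) :=
  {z | |z 0| ≤ Real.exp (2 * q) ∧ |z 1| ≤ Real.exp (-q) ∧ |z 2| ≤ Real.exp (-q)}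

/-- The `j`-th successive minimum `λ_j(q)` of `K(q)` with respect to `Λ`:
the infimum of all `λ > 0` such that `λ·K(q)` contains `j` linearly independent
points of `Λ`. -/
noncomputable def lambdaMin (ξ₁ ξ₂ : ℝ) (j : ℕ) (q : ℝ) : ℝ :=
  sInf {l : ℝ | 0 < l ∧ ∃ v : Fin j → (Fin 3 → ℝ), LinearIndependent ℝ v ∧
    ∀ i, v i ∈ LatticeSet ξ₁ ξ₂ ∧ v i ∈ l • Box q}

/-- `L_j(q) = log λ_j(q)`. -/
noncomputable def Lmin (ξ₁ ξ₂ : ℝ) (j : ℕ) (q : ℝ) : ℝ :=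
  Real.log (lambdaMin ξ₁ ξ₂ j q)

/-- `φ̲_j = liminf_{q → ∞} L_j(q)/q`. -/
noncomputable def phiLow (ξ₁ ξ₂ : ℝ) (j : ℕ) : ℝ :=
  liminf (fun q : ℝ => Lmin ξ₁ ξ₂ j q / q) atTop

/-- `φ̄_j = limsup_{q → ∞} L_j(q)/q`. -/
noncomputable def phiUp (ξ₁ ξ₂ : ℝ) (j : ℕ) : ℝ :=
  limsup (fun q : ℝ => Lmin ξ₁ ξ₂ j q / q) atTop

open MeasureTheory in
/-- Minkowski's theorem on linear forms. -/
theorem exists_int_ne_zero_abs_mulVec_lt_one {n : ℕ} (G : Matrix (Fin n) (Fin n) ℝ)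
    (h0 : G.det ≠ 0) (h1 : |G.det| < 1) :
    ∃ m : Fin n → ℤ, m ≠ 0 ∧ ∀ i, |(G.mulVec fun j => (m j : ℝ)) i| < 1 := by
  let L := (Submodule.span ℤ (Set.range (Pi.basisFun ℝ (Fin n)))).toAddSubgroup
  let s : Set (Fin n → ℝ) := (Matrix.toLin' G) ⁻¹' (Set.univ.pi fun _ => Set.Ioo (-1 : ℝ) 1)
  have hF := ZSpan.isAddFundamentalDomain (Pi.basisFun ℝ (Fin n)) volume
  have : Countable L :=
    inferInstanceAs (Countable (Submodule.span ℤ (Set.range (Pi.basisFun ℝ (Fin n)))))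
  have hsymm : ∀ x ∈ s, -x ∈ s := by
    intro x hx
    simp only [s, Set.mem_preimage, Set.mem_univ_pi, map_neg, Pi.neg_apply, Set.mem_Ioo] at hx ⊢
    intro i
    constructor <;> linarith [(hx i).1, (hx i).2]
  have hconv : Convex ℝ s :=
    (convex_pi fun i _ => convex_Ioo (-1 : ℝ) 1).linear_preimage _
  have hdet : LinearMap.det (Matrix.toLin' G) ≠ 0 := by rwa [LinearMap.det_toLin']
  have hvol : volume (ZSpan.fundamentalDomain (Pi.basisFun ℝ (Fin n))) *
      2 ^ Module.finrank ℝ (Fin n → ℝ) < volume s := by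
    rw [Measure.addHaar_preimage_linearMap _ hdet, LinearMap.det_toLin', Real.volume_pi_Ioo,
      ZSpan.fundamentalDomain_pi_basisFun, Real.volume_pi_Ico]
    have h2 : (1 : ℝ) - -1 = 2 := by norm_num
    simp only [sub_zero, ENNReal.ofReal_one, Finset.prod_const, one_pow, one_mul,
      Module.finrank_fin_fun, h2, Finset.card_univ, Fintype.card_fin]
    have h3 : ENNReal.ofReal 2 = 2 := by norm_num
    rw [h3]
    have h4 : (1 : ENNReal) < ENNReal.ofReal |G.det⁻¹| := by
      rw [← ENNReal.ofReal_one, ENNReal.ofReal_lt_ofReal_iff_of_nonneg zero_le_one, abs_inv]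
      exact (one_lt_inv₀ (abs_pos.2 h0)).2 h1
    calc (2 : ENNReal) ^ n = 1 * 2 ^ n := (one_mul _).symm
      _ < _ := ENNReal.mul_lt_mul_left (by simp) (by simp) h4
  obtain ⟨x, hx0, hx⟩ :=
    exists_ne_zero_mem_lattice_of_measure_mul_two_pow_lt_measure (L := L) hF hsymm hconv hvol
  have hmem := (Module.Basis.mem_span_iff_repr_mem ℤ (Pi.basisFun ℝ (Fin n)) (x : Fin n → ℝ)).1 x.2
  choose m hm using hmem
  have hxm : (x : Fin n → ℝ) = fun j => (m j : ℝ) := by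
    funext j
    have := hm j
    simp only [Pi.basisFun_repr] at this
    rw [← this]; simp
  refine ⟨m, ?_, ?_⟩
  · rintro rfl
    apply hx0
    apply Subtype.ext
    rw [hxm]
    funext j
    simp
  · intro i
    rw [hxm] at hx
    simp only [s, Set.mem_preimage, Set.mem_univ_pi, Set.mem_Ioo, Matrix.toLin'_apply] at hx
    exact abs_lt.2 (hx i)

theorem Set.exists_min_of_finite_sublevels {α : Type*} (N : α → ℝ)
    (hN : ∀ C, {w | N w ≤ C}.Finite) (S : Set α) (hS : S.Nonempty) :
    ∃ v ∈ S, ∀ w ∈ S, N v ≤ N w := by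
  obtain ⟨w₀, hw₀⟩ := hS
  obtain ⟨v, hv, hmin⟩ := Set.exists_min_image (S ∩ {w | N w ≤ N w₀}) N
    ((hN _).subset Set.inter_subset_right) ⟨w₀, hw₀, le_refl (N w₀)⟩
  refine ⟨v, hv.1, fun w hw => ?_⟩
  by_cases h : N w ≤ N w₀
  · exact hmin w ⟨hw, h⟩
  · exact hv.2.trans (not_le.1 h).le

/-- Minkowski's second theorem for a Euclidean ball in dimension three. -/
theorem exists_successive_minima_vectors (A : Matrix (Fin 3) (Fin 3) ℝ) (hA : |A.det| = 1)
    (F : (Fin 3 → ℤ) → EuclideanSpace ℝ (Fin 3))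
    (hF : ∀ w, F w = WithLp.toLp 2 (A.mulVec fun j => (w j : ℝ)))
    (hfin : ∀ C, {w | ‖F w‖ ≤ C}.Finite) :
    ∃ v : Fin 3 → (Fin 3 → ℤ), LinearIndependent ℝ (fun i => F (v i)) ∧
      (∀ w ≠ 0, ‖F (v 0)‖ ≤ ‖F w‖) ∧ ‖F (v 0)‖ ≤ ‖F (v 1)‖ ∧ ‖F (v 1)‖ ≤ ‖F (v 2)‖ ∧
      ‖F (v 0)‖ * ‖F (v 1)‖ * ‖F (v 2)‖ ≤ 27 := by
  have hdet : A.det ≠ 0 := by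
    intro h
    simp [h] at hA
  have hinj : ∀ w, F w = 0 → w = 0 := by
    intro w hw
    rw [hF] at hw
    have h1 : A.mulVec (fun j => (w j : ℝ)) = 0 := by
      simpa using congrArg (WithLp.ofLp) hw
    have h2 := Matrix.eq_zero_of_mulVec_eq_zero hdet h1
    funext j
    have := congrFun h2 j
    simpa using this
  have hspan : ∀ S : Submodule ℝ (EuclideanSpace ℝ (Fin 3)), Module.finrank ℝ S < 3 →
      ∃ w, F w ∉ S := by
    intro S hS
    by_contra! hall
    have htop : S = ⊤ := by
      rw [eq_top_iff]
      intro z _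
      obtain ⟨c, hc⟩ : ∃ c : Fin 3 → ℝ, A.mulVec c = WithLp.ofLp z := by
        refine ⟨A⁻¹.mulVec (WithLp.ofLp z), ?_⟩
        rw [Matrix.mulVec_mulVec, Matrix.mul_nonsing_inv _ (Ne.isUnit hdet), Matrix.one_mulVec]
      have : z = ∑ i, c i • F (Pi.single i 1) := by
        apply WithLp.ofLp_injective 2
        rw [← hc, WithLp.ofLp_sum]
        funext j
        simp only [hF, WithLp.ofLp_smul, Finset.sum_apply, Pi.smul_apply, smul_eq_mul,
          Matrix.mulVec, dotProduct]
        refine Finset.sum_congr rfl fun i _ => ?_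
        rw [Finset.sum_eq_single i]
        · simp [mul_comm]
        · intro b _ hb
          simp [hb]
        · simp
      rw [this]
      exact Submodule.sum_mem _ fun i _ => S.smul_mem _ (hall _)
    rw [htop] at hS
    simp at hS
  have hmin : ∀ S : Submodule ℝ (EuclideanSpace ℝ (Fin 3)), Module.finrank ℝ S < 3 →
      ∃ v, F v ∉ S ∧ ∀ w, F w ∉ S → ‖F v‖ ≤ ‖F w‖ := fun S hS =>
    Set.exists_min_of_finite_sublevels (fun w => ‖F w‖) hfin {w | F w ∉ S} (hspan S hS)
  obtain ⟨v0, hv0, hm0⟩ := hmin ⊥ (by simp)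
  obtain ⟨v1, hv1, hm1⟩ := hmin (Submodule.span ℝ {F v0})
    ((finrank_span_le_card _).trans_lt (by simp))
  obtain ⟨v2, hv2, hm2⟩ := hmin (Submodule.span ℝ {F v0, F v1})
    (by
      classical
      refine (finrank_span_le_card _).trans_lt ?_
      rw [Set.toFinset_insert, Set.toFinset_singleton]
      exact (Finset.card_le_two).trans_lt (by norm_num))
  have hle01 : Submodule.span ℝ {F v0} ≤ Submodule.span ℝ {F v0, F v1} :=
    Submodule.span_mono (by simp)
  have hn0 : 0 < ‖F v0‖ := norm_pos_iff.2 (by simpa using hv0)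
  have h01 : ‖F v0‖ ≤ ‖F v1‖ := hm0 _ fun h => hv1 (by
    rw [(Submodule.mem_bot ℝ).1 h]; exact Submodule.zero_mem _)
  have h12 : ‖F v1‖ ≤ ‖F v2‖ := hm1 _ fun h => hv2 (hle01 h)
  have hn1 := hn0.trans_le h01
  have hn2 := hn1.trans_le h12
  refine ⟨![v0, v1, v2], ?_, ?_, h01, h12, ?_⟩
  · have e : (fun i => F (![v0, v1, v2] i)) = ![F v0, F v1, F v2] := by
      funext i; fin_cases i <;> rfl
    rw [e, linearIndependent_finSucc']
    have e2 : Fin.init ![F v0, F v1, F v2] = ![F v0, F v1] := by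
      funext i; fin_cases i <;> rfl
    rw [e2]
    refine ⟨?_, ?_⟩
    · rw [linearIndependent_finSucc']
      have e3 : Fin.init ![F v0, F v1] = ![F v0] := by
        funext i; fin_cases i; rfl
      rw [e3]
      refine ⟨?_, ?_⟩
      · rw [linearIndependent_unique_iff]
        simpa using hv0
      · simpa [Matrix.range_cons, Matrix.range_empty] using hv1
    · have e4 : Set.range ![F v0, F v1] = {F v0, F v1} := by
        rw [Matrix.range_cons, Matrix.range_cons, Matrix.range_empty, Set.union_empty]
        rfl
      rw [e4]
      exact hv2
  · intro w hw
    exact hm0 w fun h => hw (hinj w (by simpa using h))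
  · change ‖F v0‖ * ‖F v1‖ * ‖F v2‖ ≤ 27
    by_contra! hlt
    set b := InnerProductSpace.gramSchmidtOrthonormalBasis (𝕜 := ℝ)
      (E := EuclideanSpace ℝ (Fin 3)) (ι := Fin 3) (by simp) ![F v0, F v1, F v2] with hb
    have hb10 : inner ℝ (b 1) (F v0) = 0 :=
      InnerProductSpace.gramSchmidtOrthonormalBasis_inv_triangular _ ![F v0, F v1, F v2]
        (i := 0) (j := 1) (by decide)
    have hb20 : inner ℝ (b 2) (F v0) = 0 :=
      InnerProductSpace.gramSchmidtOrthonormalBasis_inv_triangular _ ![F v0, F v1, F v2]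
        (i := 0) (j := 2) (by decide)
    have hb21 : inner ℝ (b 2) (F v1) = 0 :=
      InnerProductSpace.gramSchmidtOrthonormalBasis_inv_triangular _ ![F v0, F v1, F v2]
        (i := 1) (j := 2) (by decide)
    let Q : Matrix (Fin 3) (Fin 3) ℝ := Matrix.of fun i j => b i j
    let n : Fin 3 → ℝ := ![‖F v0‖, ‖F v1‖, ‖F v2‖]
    have hnpos : ∀ i, 0 < n i := by
      intro i; fin_cases i
      exacts [hn0, hn1, hn2]
    have hQ : |Q.det| = 1 := by
      have h := OrthonormalBasis.toMatrix_orthonormalBasis_mem_orthogonal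
        (EuclideanSpace.basisFun (Fin 3) ℝ) b
      have hT : (EuclideanSpace.basisFun (Fin 3) ℝ).toBasis.toMatrix ⇑b = Q.transpose := by
        ext i j
        simp [Module.Basis.toMatrix_apply, Q]
      rw [hT] at h
      have h2 := congrArg Matrix.det ((Matrix.mem_orthogonalGroup_iff _ _).1 h)
      rw [Matrix.det_mul, Matrix.det_one] at h2
      simp only [Matrix.transpose_transpose, Matrix.det_transpose] at h2
      have h3 : |Q.det| * |Q.det| = 1 := by rw [← abs_mul, h2, abs_one]
      nlinarith [abs_nonneg Q.det]
    let G : Matrix (Fin 3) (Fin 3) ℝ := Matrix.diagonal (fun i => 3 / n i) * (Q * A)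
    have hGdet : |G.det| = 27 / (‖F v0‖ * ‖F v1‖ * ‖F v2‖) := by
      simp only [G, Matrix.det_mul, Matrix.det_diagonal, abs_mul, hQ, hA, mul_one]
      rw [abs_of_pos (Finset.prod_pos fun i _ => div_pos three_pos (hnpos i)), Fin.prod_univ_three]
      simp only [n, Matrix.cons_val_zero, Matrix.cons_val_one, Matrix.cons_val]
      field_simp
      norm_num
    obtain ⟨m, hm, hmlt⟩ := exists_int_ne_zero_abs_mulVec_lt_one G
      (by
        rw [← abs_pos, hGdet]
        positivity)
      (by
        rw [hGdet, div_lt_one (by positivity)]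
        exact hlt)
    have hinner : ∀ i, |inner ℝ (b i) (F m)| < n i / 3 := by
      intro i
      have h := hmlt i
      have e : (G.mulVec fun j => (m j : ℝ)) i = 3 / n i * inner ℝ (b i) (F m) := by
        simp only [G, ← Matrix.mulVec_mulVec, Matrix.mulVec_diagonal, hF]
        congr 1
        simp only [PiLp.inner_apply, Matrix.mulVec, dotProduct, Q, Matrix.of_apply]
        refine Finset.sum_congr rfl fun j _ => ?_
        simp [mul_comm]
      rw [e, abs_mul, abs_of_pos (div_pos three_pos (hnpos i)), div_mul_eq_mul_div,
        div_lt_one (hnpos i)] at h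
      linarith
    have i0 : |inner ℝ (b 0) (F m)| < ‖F v0‖ / 3 := hinner 0
    have i1 : |inner ℝ (b 1) (F m)| < ‖F v1‖ / 3 := hinner 1
    have i2 : |inner ℝ (b 2) (F m)| < ‖F v2‖ / 3 := hinner 2
    have hsum : inner ℝ (b 0) (F m) ^ 2 + inner ℝ (b 1) (F m) ^ 2 + inner ℝ (b 2) (F m) ^ 2
        = ‖F m‖ ^ 2 := by
      have := b.sum_sq_norm_inner_right (F m)
      simpa [Fin.sum_univ_three] using this
    have sq : ∀ x c : ℝ, |x| < c / 3 → x ^ 2 ≤ (c / 3) ^ 2 := fun x c h =>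
      sq_le_sq' (by linarith [(abs_lt.1 h).1]) (abs_lt.1 h).2.le
    have s0 := sq _ _ i0
    have s1 := sq _ _ i1
    have s2 := sq _ _ i2
    by_cases c2 : F m ∈ Submodule.span ℝ {F v0, F v1}
    · have z2 : inner ℝ (b 2) (F m) = 0 := by
        obtain ⟨s, t, hst⟩ := Submodule.mem_span_pair.1 c2
        rw [← hst, inner_add_right, inner_smul_right, inner_smul_right, hb20, hb21]
        simp
      by_cases c1 : F m ∈ Submodule.span ℝ {F v0}
      · have z1 : inner ℝ (b 1) (F m) = 0 := by
          obtain ⟨s, hs⟩ := Submodule.mem_span_singleton.1 c1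
          rw [← hs, inner_smul_right, hb10, mul_zero]
        have := hm0 m fun h => hm (hinj m (by simpa using h))
        rw [z1, z2] at hsum
        nlinarith
      · have := hm1 m c1
        rw [z2] at hsum
        nlinarith
    · have := hm2 m c2
      nlinarith

/-- Three additive real-valued forms on `ℤ³`; `φ` is to be scaled by `e^{-2q}` and `ψ₁`, `ψ₂`
by `e^q`. -/
structure FormTriple where
  φ : (Fin 3 → ℤ) →+ ℝ
  ψ₁ : (Fin 3 → ℤ) →+ ℝ
  ψ₂ : (Fin 3 → ℤ) →+ ℝ

namespace FormTriple

/-- The absolute value of the first form. -/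
def f (P : FormTriple) (u : Fin 3 → ℤ) : ℝ := |P.φ u|

/-- The maximum of the absolute values of the last two forms. -/
def g (P : FormTriple) (u : Fin 3 → ℤ) : ℝ := max |P.ψ₁ u| |P.ψ₂ u|

/-- The rescaled sup norm at time `q`. -/
noncomputable def N (P : FormTriple) (q : ℝ) (u : Fin 3 → ℤ) : ℝ :=
  max (Real.exp (-2 * q) * P.f u) (Real.exp q * P.g u)

/-- The values of `Q` on a cross product are the minors of the values of `P`, up to sign. -/
structure IsWedge (P Q : FormTriple) : Prop where
  φ_cross : ∀ u v, |Q.φ (crossProduct u v)| = |P.ψ₁ u * P.ψ₂ v - P.ψ₂ u * P.ψ₁ v|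
  ψ₁_cross : ∀ u v, |Q.ψ₁ (crossProduct u v)| = |P.φ u * P.ψ₁ v - P.φ v * P.ψ₁ u|
  ψ₂_cross : ∀ u v, |Q.ψ₂ (crossProduct u v)| = |P.φ u * P.ψ₂ v - P.φ v * P.ψ₂ u|

variable {P Q : FormTriple}

theorem f_nonneg (u) : 0 ≤ P.f u := abs_nonneg _

theorem g_nonneg (u) : 0 ≤ P.g u := le_max_of_le_left (abs_nonneg _)

theorem f_le_N (q : ℝ) (u) : P.f u ≤ Real.exp (2 * q) * P.N q u := by
  have h : Real.exp (-2 * q) * P.f u ≤ P.N q u := le_max_left _ _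
  calc P.f u = Real.exp (2 * q) * (Real.exp (-2 * q) * P.f u) := by
        rw [← mul_assoc, ← Real.exp_add]; ring_nf; simp
    _ ≤ _ := by gcongr

theorem g_le_N (q : ℝ) (u) : P.g u ≤ Real.exp (-q) * P.N q u := by
  have h : Real.exp q * P.g u ≤ P.N q u := le_max_right _ _
  calc P.g u = Real.exp (-q) * (Real.exp q * P.g u) := by
        rw [← mul_assoc, ← Real.exp_add]; ring_nf; simp
    _ ≤ _ := by gcongr

theorem N_le_iff {q c : ℝ} {u} :
    P.N q u ≤ c ↔ P.f u ≤ Real.exp (2 * q) * c ∧ P.g u ≤ Real.exp (-q) * c := by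
  constructor
  · intro h
    exact ⟨(f_le_N q u).trans (by gcongr), (g_le_N q u).trans (by gcongr)⟩
  · rintro ⟨h1, h2⟩
    refine max_le ?_ ?_
    · calc Real.exp (-2 * q) * P.f u ≤ Real.exp (-2 * q) * (Real.exp (2 * q) * c) := by gcongr
        _ = c := by rw [← mul_assoc, ← Real.exp_add]; ring_nf; simp
    · calc Real.exp q * P.g u ≤ Real.exp q * (Real.exp (-q) * c) := by gcongr
        _ = c := by rw [← mul_assoc, ← Real.exp_add]; ring_nf; simp

theorem le_N_iff {q c : ℝ} {u} :
    c ≤ P.N q u ↔ Real.exp (2 * q) * c ≤ P.f u ∨ Real.exp (-q) * c ≤ P.g u := by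
  have e1 : Real.exp (2 * q) * (Real.exp (-2 * q) * P.f u) = P.f u := by
    rw [← mul_assoc, ← Real.exp_add]; ring_nf; simp
  have e2 : Real.exp (-q) * (Real.exp q * P.g u) = P.g u := by
    rw [← mul_assoc, ← Real.exp_add]; ring_nf; simp
  rw [N, le_max_iff]
  nth_rewrite 2 [← e1]
  nth_rewrite 2 [← e2]
  rw [mul_le_mul_iff_right₀ (Real.exp_pos _), mul_le_mul_iff_right₀ (Real.exp_pos _)]

theorem N_nonneg (q : ℝ) (u) : 0 ≤ P.N q u :=
  le_max_of_le_left (mul_nonneg (Real.exp_pos _).le (f_nonneg u))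

theorem f_neg (u) : P.f (-u) = P.f u := by simp [f]

theorem g_neg (u) : P.g (-u) = P.g u := by simp [g]

theorem abs_ψ₁_le (u) : |P.ψ₁ u| ≤ P.g u := le_max_left _ _

theorem abs_ψ₂_le (u) : |P.ψ₂ u| ≤ P.g u := le_max_right _ _

theorem abs_mul_sub_mul_le {a b c d A B C D : ℝ} (ha : |a| ≤ A) (hb : |b| ≤ B) (hc : |c| ≤ C)
    (hd : |d| ≤ D) : |a * b - c * d| ≤ A * B + C * D := by
  refine (abs_sub _ _).trans ?_
  rw [abs_mul, abs_mul]
  have := (abs_nonneg a).trans ha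
  have := (abs_nonneg c).trans hc
  gcongr

theorem IsWedge.f_cross_le (h : IsWedge P Q) (u v) :
    Q.f (crossProduct u v) ≤ 2 * (P.g u * P.g v) := by
  rw [f, h.φ_cross]
  refine (abs_mul_sub_mul_le (abs_ψ₁_le u) (abs_ψ₂_le v) (abs_ψ₂_le u) (abs_ψ₁_le v)).trans ?_
  linarith

theorem IsWedge.g_cross_le (h : IsWedge P Q) (u v) :
    Q.g (crossProduct u v) ≤ P.f u * P.g v + P.f v * P.g u := by
  rw [g, h.ψ₁_cross, h.ψ₂_cross]
  exact max_le (abs_mul_sub_mul_le le_rfl (abs_ψ₁_le v) le_rfl (abs_ψ₁_le u))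
    (abs_mul_sub_mul_le le_rfl (abs_ψ₂_le v) le_rfl (abs_ψ₂_le u))

theorem IsWedge.N_cross_le (h : IsWedge P Q) (q : ℝ) (u v) :
    Q.N (-q) (crossProduct u v) ≤ 2 * (P.N q u * P.N q v) := by
  have fu := f_le_N (P := P) q u
  have fv := f_le_N (P := P) q v
  have gu := g_le_N (P := P) q u
  have gv := g_le_N (P := P) q v
  have nu := N_nonneg (P := P) q u
  have nv := N_nonneg (P := P) q v
  have := f_nonneg (P := P) u
  have := f_nonneg (P := P) v
  have := g_nonneg (P := P) u
  have := g_nonneg (P := P) v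
  rw [N_le_iff]
  constructor
  · calc _ ≤ _ := h.f_cross_le u v
      _ ≤ 2 * ((Real.exp (-q) * P.N q u) * (Real.exp (-q) * P.N q v)) := by gcongr
      _ = (Real.exp (-q) * Real.exp (-q)) * (2 * (P.N q u * P.N q v)) := by ring
      _ = _ := by rw [← Real.exp_add]; ring_nf
  · calc _ ≤ _ := h.g_cross_le u v
      _ ≤ (Real.exp (2 * q) * P.N q u) * (Real.exp (-q) * P.N q v) +
          (Real.exp (2 * q) * P.N q v) * (Real.exp (-q) * P.N q u) := by gcongr
      _ = (Real.exp (2 * q) * Real.exp (-q)) * (2 * (P.N q u * P.N q v)) := by ring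
      _ = _ := by rw [← Real.exp_add]; ring_nf

theorem IsWedge.f_mul_g_eq (h : IsWedge P Q) {u v} (huv : crossProduct u v = 0) :
    P.f u * P.g v = P.f v * P.g u := by
  have h1 := h.ψ₁_cross u v
  have h2 := h.ψ₂_cross u v
  rw [huv, map_zero, abs_zero, eq_comm, abs_eq_zero, sub_eq_zero] at h1 h2
  rw [f, f, g, g, mul_max_of_nonneg _ _ (abs_nonneg _), mul_max_of_nonneg _ _ (abs_nonneg _),
    ← abs_mul, ← abs_mul, ← abs_mul, ← abs_mul, h1, h2]

theorem IsWedge.quarter_le_g_cross_of_nonneg (h : IsWedge P Q) {X δ : ℝ} (hX : 0 < X) (hδ : 0 < δ)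
    (hempty : ∀ w ≠ 0, X ≤ P.f w ∨ δ ≤ P.g w) {x x' : Fin 3 → ℤ} (hfx : P.f x ≤ X)
    (hgx : P.g x = δ) (hfx' : P.f x' = X) (hgx' : P.g x' ≤ δ) (hne : x' ≠ x)
    (hsign : 0 ≤ P.φ x * P.φ x') : X * δ / 4 ≤ Q.g (crossProduct x x') := by
  by_contra! hlt
  have hc1 : |P.φ x * P.ψ₁ x' - P.φ x' * P.ψ₁ x| < X * δ / 4 :=
    (h.ψ₁_cross x x').symm.trans_lt ((abs_ψ₁_le _).trans_lt hlt)
  have hc2 : |P.φ x * P.ψ₂ x' - P.φ x' * P.ψ₂ x| < X * δ / 4 :=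
    (h.ψ₂_cross x x').symm.trans_lt ((abs_ψ₂_le _).trans_lt hlt)
  have key : ∀ s s' : ℝ, |s| = δ → |s'| ≤ δ → |P.φ x * s' - P.φ x' * s| < X * δ / 4 →
      3 / 4 * X ≤ P.f x := by
    intro s s' hs hs' hss
    have h1 : |P.φ x' * s| ≤ |P.φ x * s' - P.φ x' * s| + |P.φ x * s'| := by
      have := abs_sub_abs_le_abs_sub (P.φ x' * s) (P.φ x * s')
      rw [abs_sub_comm] at this
      linarith
    rw [abs_mul, abs_mul (P.φ x), hs] at h1
    change P.f x' * δ ≤ _ + P.f x * |s'| at h1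
    rw [hfx'] at h1
    have h2 : P.f x * |s'| ≤ P.f x * δ := mul_le_mul_of_nonneg_left hs' (f_nonneg x)
    nlinarith
  have hf : 3 / 4 * X ≤ P.f x := by
    rcases max_choice |P.ψ₁ x| |P.ψ₂ x| with e | e
    · exact key _ _ (e.symm.trans hgx) ((abs_ψ₁_le x').trans hgx') hc1
    · exact key _ _ (e.symm.trans hgx) ((abs_ψ₂_le x').trans hgx') hc2
  have hφ : |P.φ x' - P.φ x| ≤ X / 4 := by
    have h1 : |P.φ x' - P.φ x| = |P.f x' - P.f x| := by
      rw [← sq_eq_sq₀ (abs_nonneg _) (abs_nonneg _), sq_abs, sq_abs, f, f]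
      have e : |P.φ x'| * |P.φ x| = P.φ x * P.φ x' := by
        rw [← abs_mul, mul_comm, abs_of_nonneg hsign]
      nlinarith [sq_abs (P.φ x'), sq_abs (P.φ x)]
    rw [h1, hfx', abs_of_nonneg (by linarith)]
    linarith
  have key2 : ∀ s s' : ℝ, |s'| ≤ δ → |P.φ x * s' - P.φ x' * s| < X * δ / 4 → |s' - s| < δ := by
    intro s s' hs' hss
    have h1 : |P.φ x' * (s' - s)| ≤ |P.φ x * s' - P.φ x' * s| + |(P.φ x' - P.φ x) * s'| := by
      rw [show P.φ x' * (s' - s) = (P.φ x * s' - P.φ x' * s) + (P.φ x' - P.φ x) * s' by ring]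
      exact abs_add_le _ _
    rw [abs_mul, abs_mul (P.φ x' - P.φ x)] at h1
    change P.f x' * _ ≤ _ at h1
    rw [hfx'] at h1
    have h2 : |P.φ x' - P.φ x| * |s'| ≤ X / 4 * δ :=
      mul_le_mul hφ hs' (abs_nonneg _) (by positivity)
    have h3 : X * |s' - s| < X * δ := by nlinarith
    exact lt_of_mul_lt_mul_left h3 hX.le
  rcases hempty (x' - x) (sub_ne_zero.2 hne) with h1 | h1
  · rw [f, map_sub] at h1
    linarith
  · rw [g, map_sub, map_sub] at h1
    have := max_lt (key2 (P.ψ₁ x) (P.ψ₁ x') ((abs_ψ₁_le x').trans hgx') hc1)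
      (key2 (P.ψ₂ x) (P.ψ₂ x') ((abs_ψ₂_le x').trans hgx') hc2)
    linarith

/-- Two minimal points on the boundary of an empty box have a cross product which is not small. -/
theorem IsWedge.quarter_le_g_cross (h : IsWedge P Q) {X δ : ℝ} (hX : 0 < X) (hδ : 0 < δ)
    (hempty : ∀ w ≠ 0, X ≤ P.f w ∨ δ ≤ P.g w) {x x' : Fin 3 → ℤ} (hfx : P.f x ≤ X)
    (hgx : P.g x = δ) (hfx' : P.f x' = X) (hgx' : P.g x' ≤ δ) (hne : x' ≠ x) (hne' : x' ≠ -x) :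
    X * δ / 4 ≤ Q.g (crossProduct x x') := by
  rcases le_total 0 (P.φ x * P.φ x') with hs | hs
  · exact h.quarter_le_g_cross_of_nonneg hX hδ hempty hfx hgx hfx' hgx' hne hs
  · have := h.quarter_le_g_cross_of_nonneg (x := -x) hX hδ hempty (by rwa [f_neg])
      (by rwa [g_neg]) hfx' hgx' hne' (by rw [map_neg]; linarith)
    rwa [map_neg, LinearMap.neg_apply, g_neg] at this

/-- At a local maximum `-m` of the first minimum of `P` at time `q`, the dual first minimum at
time `q - m` is at least `-m - O(1)`. -/
theorem IsWedge.le_N_of_empty_box (h : IsWedge P Q) (h' : IsWedge Q P) {c K q m : ℝ} (hc : 0 < c)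
    (hK : 0 ≤ K) (hm : -K ≤ m)
    (hempty : ∀ w ≠ 0, Real.exp (2 * q - m) ≤ P.f w ∨ Real.exp (-q - m) ≤ P.g w)
    {x x' : Fin 3 → ℤ} (hfx : P.f x ≤ Real.exp (2 * q - m)) (hgx : P.g x = Real.exp (-q - m))
    (hfx' : P.f x' = Real.exp (2 * q - m)) (hgx' : P.g x' ≤ Real.exp (-q - m)) (hne : x' ≠ x)
    (hne' : x' ≠ -x) (htrans : ∀ y ≠ 0, c * Real.exp (-2 * m) ≤ Q.N (-q) y) {y : Fin 3 → ℤ}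
    (hy : y ≠ 0) :
    min (c / 8) (Real.exp (-3 * K) / 4) * Real.exp (-m) ≤ Q.N (-(q - m)) y := by
  set ν := Q.N (-(q - m)) y with hν
  set z := crossProduct x x' with hz
  have hν0 : 0 ≤ ν := N_nonneg _ _
  have hGz : Real.exp (q - 2 * m) / 4 ≤ Q.g z := by
    have := h.quarter_le_g_cross (Real.exp_pos _) (Real.exp_pos _) hempty hfx hgx hfx' hgx' hne hne'
    rw [← Real.exp_add] at this
    convert this using 3
    ring
  have hFz : Q.f z ≤ 2 * Real.exp (-2 * q - 2 * m) := by
    refine (h.f_cross_le x x').trans ?_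
    rw [hgx]
    have : Real.exp (-2 * q - 2 * m) = Real.exp (-q - m) * Real.exp (-q - m) := by
      rw [← Real.exp_add]; ring_nf
    rw [this]
    gcongr
  have hGz' : Q.g z ≤ 2 * Real.exp (q - 2 * m) := by
    refine (h.g_cross_le x x').trans ?_
    rw [hgx, hfx']
    have : Real.exp (q - 2 * m) = Real.exp (2 * q - m) * Real.exp (-q - m) := by
      rw [← Real.exp_add]; ring_nf
    rw [this, two_mul (Real.exp (2 * q - m) * _)]
    gcongr
    exact g_nonneg x'
  have hFy : Q.f y ≤ Real.exp (-2 * q + 2 * m) * ν := by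
    have := f_le_N (P := Q) (-(q - m)) y
    convert this using 3
    ring
  have hGy : Q.g y ≤ Real.exp (q - m) * ν := by
    have := g_le_N (P := Q) (-(q - m)) y
    convert this using 3
    ring
  have hGyν : Real.exp (-(q - m)) * Q.g y ≤ ν := le_max_right _ _
  have e3 : Real.exp (-3 * m) ≤ Real.exp (3 * K) := Real.exp_le_exp.2 (by linarith)
  have e3' : Real.exp (-3 * K) * Real.exp (3 * K) = 1 := by rw [← Real.exp_add]; simp
  by_cases hw : crossProduct z y = 0
  · refine (mul_le_mul_of_nonneg_right (min_le_left _ _) (Real.exp_pos _).le).trans ?_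
    refine le_trans ?_ hGyν
    have hpar := h'.f_mul_g_eq hw
    suffices hs : c / 8 * Real.exp (q - 2 * m) ≤ Q.g y by
      calc c / 8 * Real.exp (-m) = Real.exp (-(q - m)) * (c / 8 * Real.exp (q - 2 * m)) := by
            rw [mul_left_comm, ← Real.exp_add]; ring_nf
        _ ≤ _ := by gcongr
    rcases le_N_iff.1 (htrans y hy) with h1 | h1
    · have h2 : Real.exp (2 * -q) * (c * Real.exp (-2 * m)) * (Real.exp (q - 2 * m) / 4) ≤
          2 * Real.exp (-2 * q - 2 * m) * Q.g y := by
        calc _ ≤ Q.f y * Q.g z := by gcongr; exact f_nonneg y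
          _ = Q.f z * Q.g y := hpar.symm
          _ ≤ _ := by gcongr; exact g_nonneg y
      have e : Real.exp (2 * -q) * (c * Real.exp (-2 * m)) = c * Real.exp (-2 * q - 2 * m) := by
        rw [mul_left_comm, ← Real.exp_add]; ring_nf
      rw [e] at h2
      have := Real.exp_pos (-2 * q - 2 * m)
      refine le_of_mul_le_mul_left ?_ this
      linarith
    · have e : Real.exp (-(-q)) * (c * Real.exp (-2 * m)) = c * Real.exp (q - 2 * m) := by
        rw [mul_left_comm, ← Real.exp_add]; ring_nf
      rw [e] at h1
      have := Real.exp_pos (q - 2 * m)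
      nlinarith
  · refine (mul_le_mul_of_nonneg_right (min_le_right _ _) (Real.exp_pos _).le).trans ?_
    rcases hempty _ hw with h1 | h1
    · have h2 : Real.exp (2 * q - m) ≤ 4 * (Real.exp (2 * q - 3 * m) * ν) := by
        calc _ ≤ _ := h1
          _ ≤ 2 * (Q.g z * Q.g y) := h'.f_cross_le z y
          _ ≤ 2 * (2 * Real.exp (q - 2 * m) * (Real.exp (q - m) * ν)) := by
            have := g_nonneg (P := Q) y
            gcongr
          _ = 4 * ((Real.exp (q - 2 * m) * Real.exp (q - m)) * ν) := by ring
          _ = _ := by rw [← Real.exp_add]; ring_nf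
      have e : Real.exp (2 * q - m) = Real.exp (2 * q - 3 * m) * Real.exp (2 * m) := by
        rw [← Real.exp_add]; ring_nf
      rw [e] at h2
      have h3 : Real.exp (2 * m) ≤ 4 * ν := by
        refine le_of_mul_le_mul_left ?_ (Real.exp_pos (2 * q - 3 * m))
        linarith
      have h4 : Real.exp (-3 * K) * Real.exp (-m) ≤ Real.exp (2 * m) := by
        rw [← Real.exp_add]
        exact Real.exp_le_exp.2 (by linarith)
      linarith
    · have h2 : Real.exp (-q - m) ≤ 2 * Real.exp (-q) * (Real.exp (-3 * m) + 1) * ν := by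
        calc _ ≤ _ := h1
          _ ≤ Q.f z * Q.g y + Q.f y * Q.g z := h'.g_cross_le z y
          _ ≤ 2 * Real.exp (-2 * q - 2 * m) * (Real.exp (q - m) * ν) +
              Real.exp (-2 * q + 2 * m) * ν * (2 * Real.exp (q - 2 * m)) := by
            have := g_nonneg (P := Q) y
            have := g_nonneg (P := Q) z
            gcongr
          _ = 2 * (Real.exp (-2 * q - 2 * m) * Real.exp (q - m) +
              Real.exp (-2 * q + 2 * m) * Real.exp (q - 2 * m)) * ν := by ring
          _ = 2 * (Real.exp (-q) * Real.exp (-3 * m) + Real.exp (-q)) * ν := by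
            simp only [← Real.exp_add]
            ring_nf
          _ = _ := by ring
      rw [sub_eq_add_neg, Real.exp_add] at h2
      have h3 : Real.exp (-m) ≤ 2 * (Real.exp (-3 * m) + 1) * ν := by
        refine le_of_mul_le_mul_left ?_ (Real.exp_pos (-q))
        linarith
      have h4 : Real.exp (-m) ≤ 2 * (Real.exp (3 * K) + 1) * ν := h3.trans (by gcongr)
      have h5 := Real.exp_pos (-3 * K)
      have h6 : Real.exp (-3 * K) ≤ 1 := Real.exp_le_one_iff.2 (by linarith)
      calc Real.exp (-3 * K) / 4 * Real.exp (-m)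
          ≤ Real.exp (-3 * K) / 4 * (2 * (Real.exp (3 * K) + 1) * ν) := by gcongr
        _ = (Real.exp (-3 * K) * Real.exp (3 * K) + Real.exp (-3 * K)) / 2 * ν := by ring
        _ ≤ _ := by rw [e3']; nlinarith

end FormTriple

theorem exists_min_of_finite_boxes {α : Type*} {f g : α → ℝ}
    (hfin : ∀ C, {u | f u ≤ C ∧ g u ≤ C}.Finite) {S : Set α} (hS : S.Nonempty) {B : ℝ}
    (hB : ∀ u ∈ S, g u ≤ B) : ∃ v ∈ S, ∀ w ∈ S, f v ≤ f w := by
  obtain ⟨w₀, hw₀⟩ := hS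
  obtain ⟨v, hv, hmin⟩ := Set.exists_min_image (S ∩ {w | f w ≤ f w₀}) f
    ((hfin (max (f w₀) B)).subset fun w hw =>
      ⟨le_max_of_le_left hw.2, le_max_of_le_right (hB w hw.1)⟩) ⟨w₀, hw₀, le_refl (f w₀)⟩
  refine ⟨v, hv.1, fun w hw => ?_⟩
  by_cases h : f w ≤ f w₀
  · exact hmin w ⟨hw, h⟩
  · exact hv.2.trans (not_le.1 h).le

/-- An empty box can be enlarged to a maximal one. -/
theorem exists_maximal_empty_box {α : Type*} {f g : α → ℝ}
    (hfin : ∀ C, {u | f u ≤ C ∧ g u ≤ C}.Finite) {S : Set α}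
    (hf : ∀ ρ > 0, ∃ u ∈ S, f u < ρ) (hg : ∀ ρ > 0, ∃ u ∈ S, g u < ρ) {T ρ : ℝ} (hT : 0 < T)
    (hρ : 0 < ρ) (hempty : ∀ u ∈ S, T ≤ f u ∨ ρ ≤ g u) :
    ∃ x ∈ S, ∃ x' ∈ S, f x < f x' ∧ g x' < ρ ∧ T ≤ f x' ∧ ρ ≤ g x ∧
      ∀ w ∈ S, f x' ≤ f w ∨ g x ≤ g w := by
  obtain ⟨x', ⟨hx'S, hx'ρ⟩, hx'⟩ := exists_min_of_finite_boxes hfin (S := {u ∈ S | g u < ρ})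
    (hg ρ hρ) (fun u hu => hu.2.le)
  have hTx' : T ≤ f x' := (hempty x' hx'S).resolve_right (not_le.2 hx'ρ)
  obtain ⟨x, ⟨hxS, hxf⟩, hx⟩ := exists_min_of_finite_boxes (f := g) (g := f)
    (fun C => (hfin C).subset fun u hu => ⟨hu.2, hu.1⟩) (S := {u ∈ S | f u < f x'})
    (hf _ (hT.trans_le hTx')) (fun u hu => hu.2.le)
  refine ⟨x, hxS, x', hx'S, hxf, hx'ρ, hTx', ?_, fun w hw => ?_⟩
  · by_contra! h
    exact (hx' x ⟨hxS, h⟩).not_gt hxf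
  · by_contra! h
    exact (hx w ⟨hw, h.1⟩).not_gt h.2

/-- The minimal point preceding a given one. -/
theorem exists_previous_minimal {α : Type*} {f g : α → ℝ}
    (hfin : ∀ C, {u | f u ≤ C ∧ g u ≤ C}.Finite) {S : Set α} {u : α}
    (hu : ∀ w ∈ S, f w < f u → g u ≤ g w) (hex : ∃ w ∈ S, f w < f u) :
    ∃ u' ∈ S, f u' < f u ∧ g u ≤ g u' ∧ ∀ w ∈ S, f u ≤ f w ∨ g u' ≤ g w := by
  obtain ⟨x, ⟨hxS, hxf⟩, hx⟩ := exists_min_of_finite_boxes (f := g) (g := f)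
    (fun C => (hfin C).subset fun u hu => ⟨hu.2, hu.1⟩) (S := {w ∈ S | f w < f u})
    hex (fun u hu => hu.2.le)
  refine ⟨x, hxS, hxf, hu x hxS hxf, fun w hw => ?_⟩
  by_contra! h
  exact (hx w ⟨hw, h.1⟩).not_gt h.2

theorem exists_exp_eq {X δ : ℝ} (hX : 0 < X) (hδ : 0 < δ) :
    ∃ q m : ℝ, X = Real.exp (2 * q - m) ∧ δ = Real.exp (-q - m) := by
  refine ⟨(Real.log X - Real.log δ) / 3, -(Real.log X + 2 * Real.log δ) / 3, ?_, ?_⟩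
  · rw [← Real.exp_log hX, Real.log_exp]; congr 1; ring
  · rw [← Real.exp_log hδ, Real.log_exp]; congr 1; ring

namespace FormTriple

variable {P Q : FormTriple}

/-- First-minimum bounds relating `P` at time `q` and `Q` at time `-q`. -/
structure Transfer (P Q : FormTriple) (C : ℝ) : Prop where
  bdd : ∀ q, ∃ u ≠ 0, P.N q u ≤ C
  sq : ∀ q, ∀ y ≠ 0, ∃ u ≠ 0, P.N q u ^ 2 ≤ C * Q.N (-q) y

theorem exp_neg_le_N_of_empty {q m : ℝ}
    (hempty : ∀ w ≠ 0, Real.exp (2 * q - m) ≤ P.f w ∨ Real.exp (-q - m) ≤ P.g w) {w : Fin 3 → ℤ}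
    (hw : w ≠ 0) : Real.exp (-m) ≤ P.N q w := by
  rw [le_N_iff, ← Real.exp_add, ← Real.exp_add]
  exact hempty w hw

theorem exists_const_of_wedge (h : IsWedge P Q) (h' : IsWedge Q P) {C : ℝ} (hC : 1 ≤ C)
    (ht : Transfer P Q C) : ∃ K, 0 ≤ K ∧ ∀ x x' q m, P.f x < P.f x' → P.g x' < P.g x →
      P.f x' = Real.exp (2 * q - m) → P.g x = Real.exp (-q - m) →
      (∀ w ≠ 0, P.f x' ≤ P.f w ∨ P.g x ≤ P.g w) →
      -K ≤ m ∧ (∀ y ≠ 0, Real.exp (-m - K) ≤ Q.N (-(q - m)) y) ∧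
      Real.exp (q - 2 * m) / 4 ≤ Q.g (crossProduct x x') ∧
      Q.g (crossProduct x x') ≤ 2 * Real.exp (q - 2 * m) := by
  have hC0 : 0 < C := by linarith
  set c' := min (1 / C / 8) (Real.exp (-3 * Real.log C) / 4) with hc'
  have hc'0 : 0 < c' := lt_min (by positivity) (by positivity)
  refine ⟨max (Real.log C) (-Real.log c'), le_max_of_le_left (Real.log_nonneg hC), ?_⟩
  intro x x' q m hf hg hX hδ hempty
  rw [hX, hδ] at hempty
  have hm : -Real.log C ≤ m := by
    obtain ⟨u, hu, huC⟩ := ht.bdd q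
    have := (exp_neg_le_N_of_empty hempty hu).trans huC
    have := (Real.le_log_iff_exp_le hC0).2 this
    linarith
  have hne : x' ≠ x := by rintro rfl; exact lt_irrefl _ hf
  have hne' : x' ≠ -x := by rintro rfl; rw [f_neg] at hf; exact lt_irrefl _ hf
  refine ⟨?_, ?_, ?_, ?_⟩
  · have := le_max_left (Real.log C) (-Real.log c')
    linarith
  · intro y hy
    have h1 := h.le_N_of_empty_box (c := 1 / C) (K := Real.log C) h' (by positivity)
      (Real.log_nonneg hC) hm hempty (hX ▸ hf.le) hδ hX (hδ ▸ hg.le) hne hne' (by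
        intro z hz
        obtain ⟨u, hu, huz⟩ := ht.sq q z hz
        have h2 := exp_neg_le_N_of_empty hempty hu
        rw [div_mul_eq_mul_div, one_mul, div_le_iff₀ hC0]
        refine le_trans ?_ (huz.trans_eq (mul_comm _ _))
        calc Real.exp (-2 * m) = Real.exp (-m) ^ 2 := by
              rw [← Real.exp_nat_mul]; congr 1; push_cast; ring
          _ ≤ _ := by gcongr) hy
    refine le_trans ?_ h1
    rw [sub_eq_add_neg, Real.exp_add, mul_comm]
    refine mul_le_mul_of_nonneg_right ?_ (Real.exp_pos _).le
    rw [← hc']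
    calc _ ≤ Real.exp (Real.log c') := Real.exp_le_exp.2 (by
            have := le_max_right (Real.log C) (-Real.log c')
            linarith)
      _ = c' := Real.exp_log hc'0
  · have := h.quarter_le_g_cross (Real.exp_pos _) (Real.exp_pos _) hempty (hX ▸ hf.le) hδ hX
      (hδ ▸ hg.le) hne hne'
    rw [← Real.exp_add] at this
    convert this using 3
    ring
  · refine (h.g_cross_le x x').trans ?_
    have e : Real.exp (q - 2 * m) = P.f x' * P.g x := by
      rw [hX, hδ, ← Real.exp_add]; ring_nf
    rw [e]
    have := mul_le_mul hf.le hg.le (g_nonneg _) (f_nonneg x')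
    linarith

/-- A minimal point of `P` and its predecessor produce a small dual point. -/
theorem exists_small_dual_point (h : IsWedge P Q)
    (hfin : ∀ C, {u | P.f u ≤ C ∧ P.g u ≤ C}.Finite) {q : ℝ} {u : Fin 3 → ℤ}
    (hmin : ∀ w ≠ 0, P.N q u ≤ P.N q w) (hfu : 0 < P.f u) (hgu : 0 < P.g u)
    (hex : ∃ w ≠ 0, P.f w < P.f u) :
    ∃ p q₀ m : ℝ, ∃ u' y : Fin 3 → ℤ, u' ≠ 0 ∧ y ≠ 0 ∧ P.f u' < P.f u ∧ P.g u ≤ P.g u' ∧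
      P.f u = Real.exp (2 * q₀ - m) ∧ P.g u' = Real.exp (-q₀ - m) ∧
      P.f u = Real.exp (2 * p - (m + 2 * (p - q₀))) ∧
      P.g u = Real.exp (-p - (m + 2 * (p - q₀))) ∧
      (∀ w ≠ 0, P.f u ≤ P.f w ∨ P.g u' ≤ P.g w) ∧
      (∀ w ≠ 0, Real.exp (-m) ≤ P.N q₀ w) ∧
      Q.N (-p) y ≤ 2 * Real.exp (-2 * m - (p - q₀)) := by
  obtain ⟨u', hu', hff, hgg, hempty⟩ := exists_previous_minimal (S := {w | w ≠ 0}) hfin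
    (u := u) (fun w hw hwu => by
      by_contra! hlt
      refine (hmin w hw).not_gt (max_lt ?_ ?_)
      · exact lt_max_of_lt_left (by gcongr)
      · exact lt_max_of_lt_right (by gcongr)) hex
  obtain ⟨q₀, m, hX, hδ⟩ := exists_exp_eq hfu (hgu.trans_le hgg)
  obtain ⟨p, k, hp, hk⟩ := exists_exp_eq hfu hgu
  have hkm : k = m + 2 * (p - q₀) := by
    have := Real.exp_injective (hX.symm.trans hp)
    linarith
  subst hkm
  have hcross : crossProduct u u' ≠ 0 := by
    intro h0
    have h1 := h.f_mul_g_eq h0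
    have h2 : P.f u' * P.g u < P.f u * P.g u' :=
      mul_lt_mul hff hgg hgu (f_nonneg u)
    linarith
  refine ⟨p, q₀, m, u', crossProduct u u', hu', hcross, hff, hgg, hX, hδ, hp, hk, hempty,
    fun w hw => exp_neg_le_N_of_empty (hX ▸ hδ ▸ hempty) hw, ?_⟩
  rw [N_le_iff]
  constructor
  · refine (h.f_cross_le u u').trans (le_of_eq ?_)
    rw [hδ, hk, ← Real.exp_add, mul_left_comm, ← Real.exp_add]
    congr 2
    ring
  · calc _ ≤ _ := h.g_cross_le u u'
      _ ≤ P.f u * P.g u' + P.f u * P.g u' := by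
        have := g_nonneg (P := P) u
        gcongr
      _ = _ := by
        rw [hX, hδ, ← Real.exp_add, ← two_mul, mul_left_comm, ← Real.exp_add]
        congr 2
        ring

end FormTriple

theorem exists_pos_le_of_finite_boxes {α : Type*} {f g : α → ℝ}
    (hfin : ∀ C, {u | f u ≤ C ∧ g u ≤ C}.Finite) {S : Set α} (hg : ∀ u ∈ S, 0 < g u) (B : ℝ) :
    ∃ ρ > 0, ∀ u ∈ S, g u < ρ → B < f u := by
  by_cases hS : {u ∈ S | f u ≤ B}.Nonempty
  · obtain ⟨v, hv, hmin⟩ := exists_min_of_finite_boxes (f := g) (g := f)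
      (fun C => (hfin C).subset fun u hu => ⟨hu.2, hu.1⟩) hS (fun u hu => hu.2)
    refine ⟨g v, hg v hv.1, fun u hu huv => ?_⟩
    by_contra! h
    exact (hmin u ⟨hu, h⟩).not_gt huv
  · refine ⟨1, one_pos, fun u hu _ => ?_⟩
    by_contra! h
    exact hS ⟨u, hu, h⟩

theorem tendsto_exp_mul_const {c : ℝ} (hc : c < 0) (D : ℝ) :
    Tendsto (fun q : ℝ => Real.exp (c * q) * D) atTop (nhds 0) := by
  have h1 : Tendsto (fun q : ℝ => c * q) atTop atBot := tendsto_id.const_mul_atTop_of_neg hc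
  simpa using (Real.tendsto_exp_atBot.comp h1).mul_const D

namespace FormTriple

variable {P Q : FormTriple}

/-- `exp (L q)` is the minimum of the norm `P.N q` on nonzero integer vectors. -/
def IsFirstMin (P : FormTriple) (L : ℝ → ℝ) : Prop :=
  ∀ q, (∃ u ≠ 0, P.N q u = Real.exp (L q)) ∧ ∀ w ≠ 0, Real.exp (L q) ≤ P.N q w

/-- Two triples of forms dual to each other, where `P` behaves like the linear forms
`x, ξ₁x - y₁, ξ₂x - y₂`. -/
structure DualPair (P Q : FormTriple) (D : ℝ) : Prop where
  one_le : 1 ≤ D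
  wedge : IsWedge P Q
  wedge' : IsWedge Q P
  finite : ∀ C, {u | P.f u ≤ C ∧ P.g u ≤ C}.Finite
  finite' : ∀ C, {u | Q.f u ≤ C ∧ Q.g u ≤ C}.Finite
  transfer : Transfer P Q D
  transfer' : Transfer Q P D
  g_pos : ∀ u ∈ {u : Fin 3 → ℤ | u ≠ 0}, 0 < P.g u
  f_pos' : ∀ u ∈ {u : Fin 3 → ℤ | u ≠ 0}, 0 < Q.f u
  unit : ∃ u ∈ {u : Fin 3 → ℤ | u ≠ 0}, P.f u = 0 ∧ P.g u = 1
  unit' : ∃ u ∈ {u : Fin 3 → ℤ | u ≠ 0}, Q.g u = 0 ∧ Q.f u = 1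
  f_or_g : ∀ u ≠ 0, 1 ≤ P.f u ∨ P.f u = 0 ∧ 1 ≤ P.g u
  g_or_f' : ∀ u ≠ 0, 1 ≤ Q.g u ∨ Q.g u = 0 ∧ 1 ≤ Q.f u
  g_int' : ∀ u, 0 < Q.g u → 1 ≤ Q.g u

theorem IsFirstMin.le_log {L : ℝ → ℝ} (hL : IsFirstMin P L) {D : ℝ} (hD : 1 ≤ D)
    (ht : Transfer P Q D) (q : ℝ) : L q ≤ Real.log D := by
  obtain ⟨u, hu, huD⟩ := ht.bdd q
  exact (Real.le_log_iff_exp_le (by linarith)).2 (((hL q).2 u hu).trans huD)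

theorem IsFirstMin.empty {L : ℝ → ℝ} (hL : IsFirstMin P L) (q : ℝ) {w : Fin 3 → ℤ} (hw : w ≠ 0) :
    Real.exp (2 * q + L q) ≤ P.f w ∨ Real.exp (-q + L q) ≤ P.g w := by
  have := (hL q).2 w hw
  rwa [le_N_iff, ← Real.exp_add, ← Real.exp_add] at this

namespace DualPair

variable {D : ℝ} {L M : ℝ → ℝ}

theorem exists_g_lt (h : DualPair P Q D) {ρ : ℝ} (hρ : 0 < ρ) :
    ∃ u ∈ {u : Fin 3 → ℤ | u ≠ 0}, P.g u < ρ := by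
  obtain ⟨q, hq⟩ := ((tendsto_exp_mul_const (c := -1) (by norm_num) D).eventually_lt_const
    hρ).exists
  obtain ⟨u, hu, huD⟩ := h.transfer.bdd q
  refine ⟨u, hu, lt_of_le_of_lt ?_ hq⟩
  simpa using (N_le_iff.1 huD).2

theorem exists_f_lt' (h : DualPair P Q D) {ρ : ℝ} (hρ : 0 < ρ) :
    ∃ u ∈ {u : Fin 3 → ℤ | u ≠ 0}, Q.f u < ρ := by
  obtain ⟨q, hq⟩ := ((tendsto_exp_mul_const (c := -2) (by norm_num) D).eventually_lt_const
    hρ).exists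
  obtain ⟨u, hu, huD⟩ := h.transfer'.bdd (-q)
  refine ⟨u, hu, lt_of_le_of_lt ?_ hq⟩
  simpa using (N_le_iff.1 huD).1

theorem neg_two_mul_le (h : DualPair P Q D) (hL : IsFirstMin P L) {q : ℝ} (hq : 0 ≤ q) :
    -2 * q ≤ L q := by
  obtain ⟨u, hu, huL⟩ := (hL q).1
  rcases h.f_or_g u hu with h1 | ⟨-, h1⟩
  · rw [← Real.exp_le_exp, ← huL]
    refine le_trans ?_ (le_max_left _ _)
    exact le_mul_of_one_le_right (Real.exp_pos _).le h1
  · have : q ≤ L q := by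
      rw [← Real.exp_le_exp, ← huL]
      refine le_trans ?_ (le_max_right _ _)
      exact le_mul_of_one_le_right (Real.exp_pos _).le h1
    linarith

theorem neg_le (h : DualPair P Q D) (hM : IsFirstMin Q M) {q : ℝ} (hq : 0 ≤ q) :
    -q ≤ M (-q) := by
  obtain ⟨u, hu, huL⟩ := (hM (-q)).1
  rcases h.g_or_f' u hu with h1 | ⟨-, h1⟩
  · rw [← Real.exp_le_exp, ← huL]
    refine le_trans ?_ (le_max_right _ _)
    exact le_mul_of_one_le_right (Real.exp_pos _).le h1
  · have : -2 * -q ≤ M (-q) := by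
      rw [← Real.exp_le_exp, ← huL]
      refine le_trans ?_ (le_max_left _ _)
      exact le_mul_of_one_le_right (Real.exp_pos _).le h1
    linarith

theorem exists_primal_local_max (h : DualPair P Q D) (hL : IsFirstMin P L) (hM : IsFirstMin Q M) :
    ∃ K, ∀ R, ∀ᶠ q in atTop, ∃ q₀ m, R ≤ q₀ ∧ -K ≤ m ∧ 2 * m ≤ q₀ + K ∧ L q * q₀ ≤ -m * q ∧
      -m - K ≤ M (-(q₀ - m)) := by
  obtain ⟨K, hK, hc⟩ := exists_const_of_wedge h.wedge h.wedge' h.one_le h.transfer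
  refine ⟨max K (Real.log 2), fun R => ?_⟩
  obtain ⟨ρ₀, hρ₀, hsmall⟩ := exists_pos_le_of_finite_boxes h.finite h.g_pos (Real.exp (3 * R))
  filter_upwards [eventually_ge_atTop (Real.log D),
    (tendsto_exp_mul_const (c := -1) (by norm_num) D).eventually_lt_const hρ₀] with q hq hqρ
  have hLD := hL.le_log h.one_le h.transfer q
  have hlogD := Real.log_nonneg h.one_le
  obtain ⟨e, he, hfe, hge⟩ := h.unit
  obtain ⟨x, hx, x', hx', hff, hgρ, hT, hρ, hempty⟩ := exists_maximal_empty_box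
    (S := {u : Fin 3 → ℤ | u ≠ 0}) h.finite (fun ρ hρ => ⟨e, he, by rwa [hfe]⟩)
    (fun ρ hρ => h.exists_g_lt hρ) (Real.exp_pos (2 * q + L q)) (Real.exp_pos (-q + L q))
    (fun u hu => hL.empty q hu)
  have hX := (Real.exp_pos _).trans_le hT
  have hδ := (Real.exp_pos _).trans_le hρ
  have hgx : P.g x ≤ 1 := by
    rcases hempty e he with h1 | h1
    · linarith
    · linarith
  have hfx' : Real.exp (3 * R) < P.f x' := by
    refine hsmall x' hx' (hgρ.trans (lt_of_le_of_lt ?_ hqρ))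
    rw [Real.exp_add, neg_one_mul]
    gcongr
    rwa [← Real.le_log_iff_exp_le (by linarith [h.one_le])]
  obtain ⟨q₀, m, hq₀, hm⟩ := exists_exp_eq hX hδ
  obtain ⟨h1, h2, h3, h4⟩ := hc x x' q₀ m hff (hgρ.trans_le hρ) hq₀ hm hempty
  have h5 := h.g_int' _ ((by positivity : (0 : ℝ) < _).trans_le h3)
  have h6 : 0 ≤ Real.log 2 + (q₀ - 2 * m) := by
    rw [← Real.exp_le_exp, Real.exp_zero, Real.exp_add, Real.exp_log two_pos]
    exact h5.trans h4
  rw [hq₀, Real.exp_lt_exp] at hfx'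
  rw [hm, ← Real.exp_zero, Real.exp_le_exp] at hgx
  rw [hq₀, Real.exp_le_exp] at hT
  rw [hm, Real.exp_le_exp] at hρ
  have hK1 := le_max_left K (Real.log 2)
  have hK2 := le_max_right K (Real.log 2)
  refine ⟨q₀, m, by linarith, by linarith, by linarith, ?_, ?_⟩
  · have h2q := h.neg_two_mul_le hL (hlogD.trans hq)
    nlinarith [mul_nonneg (sub_nonneg.2 hT) (sub_nonneg.2 (hLD.trans hq)),
      mul_nonneg (sub_nonneg.2 hρ) (sub_nonneg.2 h2q)]
  · obtain ⟨y, hy, hyM⟩ := (hM (-(q₀ - m))).1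
    have := h2 y hy
    rw [hyM, Real.exp_le_exp] at this
    linarith

theorem exists_dual_local_max (h : DualPair P Q D) (hL : IsFirstMin P L) (hM : IsFirstMin Q M) :
    ∃ K, ∀ R, ∀ᶠ q in atTop, ∃ q₁ m, R ≤ q₁ ∧ -K ≤ m ∧ m * q ≤ -M (-q) * q₁ ∧
      -m - K ≤ L (q₁ + m) := by
  obtain ⟨K, hK, hc⟩ := exists_const_of_wedge h.wedge' h.wedge h.one_le h.transfer'
  refine ⟨K, fun R => ?_⟩
  have hfin : ∀ C, {u | Q.g u ≤ C ∧ Q.f u ≤ C}.Finite :=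
    fun C => (h.finite' C).subset fun u hu => ⟨hu.2, hu.1⟩
  obtain ⟨ρ₀, hρ₀, hsmall⟩ := exists_pos_le_of_finite_boxes hfin h.f_pos' (Real.exp (3 * R))
  filter_upwards [eventually_ge_atTop (Real.log D),
    (tendsto_exp_mul_const (c := -2) (by norm_num) D).eventually_lt_const hρ₀] with q hq hqρ
  have hMD := hM.le_log h.one_le h.transfer' (-q)
  have hlogD := Real.log_nonneg h.one_le
  obtain ⟨e, he, hge, hfe⟩ := h.unit'
  obtain ⟨x, hx, x', hx', hgg, hfρ, hT, hρ, hempty⟩ := exists_maximal_empty_box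
    (S := {u : Fin 3 → ℤ | u ≠ 0}) hfin (fun ρ hρ => ⟨e, he, by rwa [hge]⟩)
    (fun ρ hρ => h.exists_f_lt' hρ) (Real.exp_pos (-(-q) + M (-q)))
    (Real.exp_pos (2 * -q + M (-q))) (fun u hu => (hM.empty (-q) hu).symm)
  have hX := (Real.exp_pos _).trans_le hT
  have hδ := (Real.exp_pos _).trans_le hρ
  have hfx : Q.f x ≤ 1 := by
    rcases hempty e he with h1 | h1
    · linarith
    · linarith
  have hgx' : Real.exp (3 * R) < Q.g x' := by
    refine hsmall x' hx' (hfρ.trans (lt_of_le_of_lt ?_ hqρ))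
    rw [Real.exp_add, mul_neg, neg_mul]
    gcongr
    rwa [← Real.le_log_iff_exp_le (by linarith [h.one_le])]
  obtain ⟨p, m, hp, hm⟩ := exists_exp_eq hδ hX
  obtain ⟨h1, h2, -, -⟩ := hc x' x p m (hfρ.trans_le hρ) hgg hp hm
    (fun w hw => (hempty w hw).symm)
  rw [hm, Real.exp_lt_exp] at hgx'
  rw [hp, ← Real.exp_zero, Real.exp_le_exp] at hfx
  rw [hm, Real.exp_le_exp] at hT
  rw [hp, Real.exp_le_exp] at hρ
  refine ⟨-p, m, by linarith, h1, ?_, ?_⟩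
  · have h2q := h.neg_le hM (hlogD.trans hq)
    have h2q' : M (-q) ≤ 2 * q := by linarith
    nlinarith [mul_nonneg (sub_nonneg.2 hρ) (sub_nonneg.2 h2q),
      mul_nonneg (sub_nonneg.2 hT) (sub_nonneg.2 h2q')]
  · obtain ⟨y, hy, hyL⟩ := (hL (-p + m)).1
    have := h2 y hy
    rw [show -(p - m) = -p + m by ring, hyL, Real.exp_le_exp] at this
    linarith

theorem exists_dual_minimal_pair (h : DualPair P Q D) (hL : IsFirstMin P L)
    (hM : IsFirstMin Q M) :
    ∀ R, ∀ᶠ q in atTop, ∃ p q₁ m, R ≤ p ∧ p ≤ q₁ ∧ -M (-q) * p ≤ (m + 2 * (q₁ - p)) * q ∧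
      -m ≤ M (-q₁) ∧ L p ≤ -2 * m - (q₁ - p) + Real.log 2 := by
  intro R
  filter_upwards [eventually_gt_atTop (Real.log D),
    eventually_ge_atTop (Real.log D + 3 * R)] with q hq hqR
  have hMD := hM.le_log h.one_le h.transfer' (-q)
  have hlogD := Real.log_nonneg h.one_le
  obtain ⟨u, hu, huM⟩ := (hM (-q)).1
  obtain ⟨huf, hug⟩ := N_le_iff.1 huM.le
  rw [← Real.exp_add] at huf hug
  have hfu := h.f_pos' u hu
  have hgu : 1 ≤ Q.g u := by
    refine (h.g_or_f' u hu).resolve_right fun h1 => ?_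
    have := h1.2.trans huf
    rw [← Real.exp_zero, Real.exp_le_exp] at this
    linarith
  obtain ⟨p, q₀, m, u', y, hu', hy, hff, hgg, e1, e2, e3, e4, -, h1, h2⟩ :=
    exists_small_dual_point h.wedge' h.finite' (fun w hw => huM.le.trans ((hM (-q)).2 w hw)) hfu
      (by linarith) (h.exists_f_lt' hfu)
  rw [e3, Real.exp_le_exp] at huf
  rw [e4, e2, Real.exp_le_exp] at hgg
  rw [e4, Real.exp_le_exp] at hug
  rw [e4, ← Real.exp_zero, Real.exp_le_exp] at hgu
  refine ⟨-p, -q₀, m, by linarith, by linarith, ?_, ?_, ?_⟩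
  · have h2q := h.neg_le hM (hlogD.trans hq.le)
    have h2q' : M (-q) ≤ 2 * q := by linarith
    nlinarith [mul_nonneg (sub_nonneg.2 huf) (sub_nonneg.2 h2q),
      mul_nonneg (sub_nonneg.2 hug) (sub_nonneg.2 h2q')]
  · obtain ⟨w, hw, hwM⟩ := (hM q₀).1
    rw [neg_neg]
    have := h1 w hw
    rwa [hwM, Real.exp_le_exp] at this
  · have := ((hL (-p)).2 y hy).trans h2
    nth_rewrite 1 [← Real.exp_log two_pos] at this
    rw [← Real.exp_add, Real.exp_le_exp] at this
    linarith

theorem exists_primal_minimal_pair (h : DualPair P Q D) (hL : IsFirstMin P L)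
    (hM : IsFirstMin Q M) :
    ∀ R, ∀ᶠ q in atTop, ∃ p q₀ m, R ≤ q₀ ∧ q₀ ≤ p ∧ -L q * p ≤ (m + 2 * (p - q₀)) * q ∧
      -m ≤ L q₀ ∧ M (-p) ≤ -2 * m - (p - q₀) + Real.log 2 := by
  intro R
  obtain ⟨ρ₀, hρ₀, hsmall⟩ := exists_pos_le_of_finite_boxes h.finite h.g_pos (Real.exp (3 * R))
  filter_upwards [eventually_gt_atTop (Real.log D),
    (tendsto_exp_mul_const (c := -1) (by norm_num) D).eventually_lt_const hρ₀] with q hq hqρ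
  have hLD := hL.le_log h.one_le h.transfer q
  have hlogD := Real.log_nonneg h.one_le
  obtain ⟨e, he, hfe, hge⟩ := h.unit
  obtain ⟨u, hu, huL⟩ := (hL q).1
  obtain ⟨huf, hug⟩ := N_le_iff.1 huL.le
  have hfu : Real.exp (3 * R) < P.f u := by
    refine hsmall u hu (lt_of_le_of_lt (hug.trans ?_) hqρ)
    rw [neg_one_mul]
    gcongr
    rwa [← Real.le_log_iff_exp_le (by linarith [h.one_le])]
  rw [← Real.exp_add] at huf hug
  have hfu0 := (Real.exp_pos _).trans hfu
  obtain ⟨p, q₀, m, u', y, hu', hy, hff, hgg, e1, e2, e3, e4, hempty, h1, h2⟩ :=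
    exists_small_dual_point h.wedge h.finite (fun w hw => huL.le.trans ((hL q).2 w hw)) hfu0
      (h.g_pos u hu) ⟨e, he, by rwa [hfe]⟩
  have hgu' : P.g u' ≤ 1 := by
    rcases hempty e he with h1 | h1
    · linarith
    · linarith
  rw [e1, Real.exp_lt_exp] at hfu
  rw [e2, ← Real.exp_zero, Real.exp_le_exp] at hgu'
  rw [e3, Real.exp_le_exp] at huf
  rw [e4, e2, Real.exp_le_exp] at hgg
  rw [e4, Real.exp_le_exp] at hug
  refine ⟨p, q₀, m, by linarith, by linarith, ?_, ?_, ?_⟩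
  · have h2q := h.neg_two_mul_le hL (hlogD.trans hq.le)
    have h2q' : L q ≤ q := by linarith
    nlinarith [mul_nonneg (sub_nonneg.2 huf) (sub_nonneg.2 h2q'),
      mul_nonneg (sub_nonneg.2 hug) (sub_nonneg.2 h2q)]
  · obtain ⟨w, hw, hwL⟩ := (hL q₀).1
    have := h1 w hw
    rwa [hwL, Real.exp_le_exp] at this
  · have := ((hM (-p)).2 y hy).trans h2
    nth_rewrite 1 [← Real.exp_log two_pos] at this
    rw [← Real.exp_add, Real.exp_le_exp] at this
    linarith

end DualPair

end FormTriple

/-- The additive map `m ↦ a m₀ + b m₁ + c m₂`. -/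
def linForm (a b c : ℝ) : (Fin 3 → ℤ) →+ ℝ where
  toFun m := a * m 0 + b * m 1 + c * m 2
  map_zero' := by simp
  map_add' u v := by
    simp only [Pi.add_apply, Int.cast_add]
    ring

theorem linForm_apply (a b c : ℝ) (m : Fin 3 → ℤ) :
    linForm a b c m = a * m 0 + b * m 1 + c * m 2 := rfl

namespace FormTriple

/-- The forms `x, ξ₁x - y₁, ξ₂x - y₂`. -/
def primal (ξ₁ ξ₂ : ℝ) : FormTriple where
  φ := linForm 1 0 0
  ψ₁ := linForm ξ₁ (-1) 0
  ψ₂ := linForm ξ₂ 0 (-1)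

/-- The forms `y₀ + ξ₁y₁ + ξ₂y₂, y₂, y₁`. -/
def dual (ξ₁ ξ₂ : ℝ) : FormTriple where
  φ := linForm 1 ξ₁ ξ₂
  ψ₁ := linForm 0 0 1
  ψ₂ := linForm 0 1 0

variable (ξ₁ ξ₂ : ℝ)

theorem isWedge_primal_dual : IsWedge (primal ξ₁ ξ₂) (dual ξ₁ ξ₂) := by
  constructor <;> intro u v <;> rw [abs_eq_abs] <;>
    simp only [primal, dual, linForm_apply, cross_apply, Matrix.cons_val] <;> push_cast
  · left; ring
  · right; ring
  · left; ring

theorem isWedge_dual_primal : IsWedge (dual ξ₁ ξ₂) (primal ξ₁ ξ₂) := by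
  constructor <;> intro u v <;> rw [abs_eq_abs] <;>
    simp only [primal, dual, linForm_apply, cross_apply, Matrix.cons_val] <;> push_cast
  · right; ring
  · left; ring
  · right; ring

theorem primal_f (m : Fin 3 → ℤ) : (primal ξ₁ ξ₂).f m = |(m 0 : ℝ)| := by
  simp [f, primal, linForm_apply]

theorem primal_g (m : Fin 3 → ℤ) :
    (primal ξ₁ ξ₂).g m = max |ξ₁ * m 0 - m 1| |ξ₂ * m 0 - m 2| := by
  simp [g, primal, linForm_apply, sub_eq_add_neg]

theorem dual_f (y : Fin 3 → ℤ) : (dual ξ₁ ξ₂).f y = |y 0 + ξ₁ * y 1 + ξ₂ * y 2| := by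
  simp [f, dual, linForm_apply]

theorem dual_g (y : Fin 3 → ℤ) : (dual ξ₁ ξ₂).g y = max |(y 2 : ℝ)| |(y 1 : ℝ)| := by
  simp [g, dual, linForm_apply]

theorem finite_of_coord_le {S : Set (Fin 3 → ℤ)} (B : ℝ) (h : ∀ m ∈ S, ∀ i, |(m i : ℝ)| ≤ B) :
    S.Finite := by
  refine (Set.finite_Icc (fun _ => -⌈B⌉) (fun _ => ⌈B⌉)).subset fun m hm => ?_
  have key : ∀ i, |m i| ≤ ⌈B⌉ := fun i => by
    have h1 := (h m hm i).trans (Int.le_ceil B)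
    exact_mod_cast h1
  exact ⟨fun i => (abs_le.1 (key i)).1, fun i => (abs_le.1 (key i)).2⟩

theorem abs_le_of_abs_mul_sub_le {ξ a b C : ℝ} (ha : |a| ≤ C) (hb : |ξ * a - b| ≤ C) :
    |b| ≤ C + |ξ| * C := by
  have h1 := abs_sub_abs_le_abs_sub b (ξ * a)
  rw [abs_sub_comm, abs_mul] at h1
  have h2 := mul_le_mul_of_nonneg_left ha (abs_nonneg ξ)
  linarith

theorem primal_finite (C : ℝ) : {u | (primal ξ₁ ξ₂).f u ≤ C ∧ (primal ξ₁ ξ₂).g u ≤ C}.Finite := by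
  refine finite_of_coord_le (C + |ξ₁| * C + |ξ₂| * C) fun m hm i => ?_
  simp only [Set.mem_ofPred_eq, primal_f, primal_g, max_le_iff] at hm
  have hC : 0 ≤ C := (abs_nonneg _).trans hm.1
  have h1 := mul_nonneg (abs_nonneg ξ₁) hC
  have h2 := mul_nonneg (abs_nonneg ξ₂) hC
  have h3 := abs_le_of_abs_mul_sub_le hm.1 hm.2.1
  have h4 := abs_le_of_abs_mul_sub_le hm.1 hm.2.2
  fin_cases i
  · exact hm.1.trans (by linarith)
  · exact h3.trans (by linarith)
  · exact h4.trans (by linarith)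

theorem dual_finite (C : ℝ) : {u | (dual ξ₁ ξ₂).f u ≤ C ∧ (dual ξ₁ ξ₂).g u ≤ C}.Finite := by
  refine finite_of_coord_le (C + |ξ₁| * C + |ξ₂| * C) fun m hm i => ?_
  simp only [Set.mem_ofPred_eq, dual_f, dual_g, max_le_iff] at hm
  have hC : 0 ≤ C := (abs_nonneg _).trans hm.1
  have h1 := mul_nonneg (abs_nonneg ξ₁) hC
  have h2 := mul_nonneg (abs_nonneg ξ₂) hC
  fin_cases i
  · have e : (m 0 : ℝ) = (m 0 + ξ₁ * m 1 + ξ₂ * m 2) - ξ₁ * m 1 - ξ₂ * m 2 := by ring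
    have h3 := mul_le_mul_of_nonneg_left hm.2.2 (abs_nonneg ξ₁)
    have h4 := mul_le_mul_of_nonneg_left hm.2.1 (abs_nonneg ξ₂)
    rw [← abs_mul] at h3 h4
    have h5 := abs_sub (m 0 + ξ₁ * m 1 + ξ₂ * m 2) (ξ₁ * m 1)
    have h6 := abs_sub ((m 0 + ξ₁ * m 1 + ξ₂ * m 2) - ξ₁ * m 1) (ξ₂ * m 2)
    rw [← e] at h6
    change |(m 0 : ℝ)| ≤ _
    linarith [hm.1]
  · exact hm.2.2.trans (by linarith)
  · exact hm.2.1.trans (by linarith)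

variable {ξ₁ ξ₂} in
theorem eq_zero_of_int_combination (hind : LinearIndependent ℚ ![(1 : ℝ), ξ₁, ξ₂]) {a b c : ℤ}
    (h : a + ξ₁ * b + ξ₂ * c = 0) : a = 0 ∧ b = 0 ∧ c = 0 := by
  have := Fintype.linearIndependent_iff.1 hind ![(a : ℚ), b, c] (by
    simp only [Fin.sum_univ_three, Matrix.cons_val, Rat.smul_def]
    push_cast
    linarith)
  have h0 := this 0
  have h1 := this 1
  have h2 := this 2
  simp only [Matrix.cons_val, Int.cast_eq_zero] at h0 h1 h2
  exact ⟨h0, h1, h2⟩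

variable {ξ₁ ξ₂} in
theorem primal_g_pos (hind : LinearIndependent ℚ ![(1 : ℝ), ξ₁, ξ₂]) {u : Fin 3 → ℤ} (hu : u ≠ 0) :
    0 < (primal ξ₁ ξ₂).g u := by
  refine lt_of_le_of_ne (g_nonneg u) fun h => hu ?_
  have h' := h.ge
  rw [primal_g, max_le_iff, abs_nonpos_iff, abs_nonpos_iff] at h'
  obtain ⟨h1, h2, -⟩ := eq_zero_of_int_combination hind (a := -u 1) (b := u 0) (c := 0)
    (by push_cast; linarith)
  obtain ⟨h3, -, -⟩ := eq_zero_of_int_combination hind (a := -u 2) (b := 0) (c := u 0)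
    (by push_cast; linarith)
  ext i
  fin_cases i
  · exact h2
  · exact neg_eq_zero.1 h1
  · exact neg_eq_zero.1 h3

variable {ξ₁ ξ₂} in
theorem dual_f_pos (hind : LinearIndependent ℚ ![(1 : ℝ), ξ₁, ξ₂]) {u : Fin 3 → ℤ} (hu : u ≠ 0) :
    0 < (dual ξ₁ ξ₂).f u := by
  refine lt_of_le_of_ne (f_nonneg u) fun h => hu ?_
  rw [dual_f, eq_comm, abs_eq_zero] at h
  obtain ⟨h1, h2, h3⟩ := eq_zero_of_int_combination hind h
  ext i
  fin_cases i
  · exact h1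
  · exact h2
  · exact h3

theorem one_le_abs_cast {n : ℤ} (hn : n ≠ 0) : (1 : ℝ) ≤ |(n : ℝ)| := by
  exact_mod_cast Int.one_le_abs hn

theorem primal_f_or_g {u : Fin 3 → ℤ} (hu : u ≠ 0) :
    1 ≤ (primal ξ₁ ξ₂).f u ∨ (primal ξ₁ ξ₂).f u = 0 ∧ 1 ≤ (primal ξ₁ ξ₂).g u := by
  rw [primal_f, primal_g]
  by_cases h0 : u 0 = 0
  · right
    simp only [h0, Int.cast_zero, abs_zero, mul_zero, zero_sub, abs_neg, true_and, le_max_iff]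
    by_cases h1 : u 1 = 0
    · by_cases h2 : u 2 = 0
      · exact (hu (by ext i; fin_cases i <;> assumption)).elim
      · exact Or.inr (one_le_abs_cast h2)
    · exact Or.inl (one_le_abs_cast h1)
  · exact Or.inl (one_le_abs_cast h0)

theorem dual_g_or_f {u : Fin 3 → ℤ} (hu : u ≠ 0) :
    1 ≤ (dual ξ₁ ξ₂).g u ∨ (dual ξ₁ ξ₂).g u = 0 ∧ 1 ≤ (dual ξ₁ ξ₂).f u := by
  rw [dual_f, dual_g]
  by_cases h1 : u 1 = 0
  · by_cases h2 : u 2 = 0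
    · have h0 : u 0 ≠ 0 := fun h0 => hu (by ext i; fin_cases i <;> assumption)
      exact Or.inr (by simpa [h1, h2] using one_le_abs_cast h0)
    · exact Or.inl (le_max_of_le_left (one_le_abs_cast h2))
  · exact Or.inl (le_max_of_le_right (one_le_abs_cast h1))

theorem one_le_dual_g {u : Fin 3 → ℤ} (hu : 0 < (dual ξ₁ ξ₂).g u) : 1 ≤ (dual ξ₁ ξ₂).g u := by
  have h0 : u ≠ 0 := by
    rintro rfl
    simp [dual_g] at hu
  exact (dual_g_or_f ξ₁ ξ₂ h0).resolve_right fun h => hu.ne' h.1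

theorem abs_dotProduct_le (q : ℝ) (y m : Fin 3 → ℤ) :
    |((y 0 * m 0 + y 1 * m 1 + y 2 * m 2 : ℤ) : ℝ)| ≤
      3 * ((dual ξ₁ ξ₂).N (-q) y * (primal ξ₁ ξ₂).N q m) := by
  set P := primal ξ₁ ξ₂
  set Q := dual ξ₁ ξ₂
  have e : ((y 0 * m 0 + y 1 * m 1 + y 2 * m 2 : ℤ) : ℝ) =
      Q.φ y * P.φ m - Q.ψ₂ y * P.ψ₁ m - Q.ψ₁ y * P.ψ₂ m := by
    simp only [P, Q, primal, dual, linForm_apply]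
    push_cast
    ring
  have h1 : |Q.φ y * P.φ m - Q.ψ₂ y * P.ψ₁ m| ≤ Q.f y * P.f m + Q.g y * P.g m :=
    abs_mul_sub_mul_le le_rfl le_rfl (abs_ψ₂_le y) (abs_ψ₁_le m)
  have h2 : |Q.ψ₁ y * P.ψ₂ m| ≤ Q.g y * P.g m := by
    rw [abs_mul]
    exact mul_le_mul (abs_ψ₁_le y) (abs_ψ₂_le m) (abs_nonneg _) (g_nonneg y)
  have h3 := abs_sub (Q.φ y * P.φ m - Q.ψ₂ y * P.ψ₁ m) (Q.ψ₁ y * P.ψ₂ m)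
  have hy := N_nonneg (P := Q) (-q) y
  have hm := N_nonneg (P := P) q m
  have h4 : Q.f y * P.f m ≤ Q.N (-q) y * P.N q m := by
    calc _ ≤ (Real.exp (2 * -q) * Q.N (-q) y) * (Real.exp (2 * q) * P.N q m) :=
          mul_le_mul (f_le_N _ y) (f_le_N _ m) (f_nonneg m) (by positivity)
      _ = (Real.exp (2 * -q) * Real.exp (2 * q)) * (Q.N (-q) y * P.N q m) := by ring
      _ = _ := by rw [← Real.exp_add]; ring_nf; simp
  have h5 : Q.g y * P.g m ≤ Q.N (-q) y * P.N q m := by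
    calc _ ≤ (Real.exp (-(-q)) * Q.N (-q) y) * (Real.exp (-q) * P.N q m) :=
          mul_le_mul (g_le_N _ y) (g_le_N _ m) (g_nonneg m) (by positivity)
      _ = (Real.exp (-(-q)) * Real.exp (-q)) * (Q.N (-q) y * P.N q m) := by ring
      _ = _ := by rw [← Real.exp_add]; ring_nf; simp
  rw [e]
  linarith

/-- Integer vectors which are independent over `ℝ` do not all lie near a given hyperplane. -/
theorem one_le_three_mul_N (q : ℝ) {v : Fin 3 → Fin 3 → ℤ}
    (hv : LinearIndependent ℝ fun i j => (v i j : ℝ)) {l : ℝ}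
    (hl : ∀ i, (primal ξ₁ ξ₂).N q (v i) ≤ l) {y : Fin 3 → ℤ} (hy : y ≠ 0) :
    1 ≤ 3 * ((dual ξ₁ ξ₂).N (-q) y * l) := by
  have hu := Matrix.linearIndependent_rows_iff_isUnit (A := fun i j => (v i j : ℝ)).1 hv
  obtain ⟨i, hi⟩ : ∃ i, y 0 * v i 0 + y 1 * v i 1 + y 2 * v i 2 ≠ 0 := by
    by_contra! h
    have h0 : Matrix.mulVec (fun i j => (v i j : ℝ)) (fun j => (y j : ℝ)) = 0 := by
      ext i
      have := congrArg (Int.cast : ℤ → ℝ) (h i)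
      push_cast at this
      simp only [Matrix.mulVec, dotProduct, Fin.sum_univ_three, Pi.zero_apply]
      linarith
    have h1 := Matrix.mulVec_injective_of_isUnit hu (h0.trans (Matrix.mulVec_zero _).symm)
    refine hy (funext fun j => ?_)
    simpa using congrFun h1 j
  refine (one_le_abs_cast hi).trans ((abs_dotProduct_le ξ₁ ξ₂ q y (v i)).trans ?_)
  have := N_nonneg (P := dual ξ₁ ξ₂) (-q) y
  have := hl i
  gcongr

/-- The matrix whose columns generate the lattice. -/
def latticeMatrix : Matrix (Fin 3) (Fin 3) ℝ := !![1, 0, 0; ξ₁, -1, 0; ξ₂, 0, -1]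

/-- The lattice point with the given integer coordinates. -/
def latticePoint (w : Fin 3 → ℤ) : Fin 3 → ℝ :=
  (latticeMatrix ξ₁ ξ₂).mulVec fun j => (w j : ℝ)

theorem latticePoint_eq (w : Fin 3 → ℤ) :
    latticePoint ξ₁ ξ₂ w = ![(w 0 : ℝ), ξ₁ * w 0 - w 1, ξ₂ * w 0 - w 2] := by
  ext i
  fin_cases i <;>
    simp [latticePoint, latticeMatrix, Matrix.mulVec, dotProduct, Fin.sum_univ_three,
      sub_eq_add_neg]

theorem linearIndependent_cast_of_latticePoint {ι : Type*} {v : ι → Fin 3 → ℤ}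
    (h : LinearIndependent ℝ fun i => latticePoint ξ₁ ξ₂ (v i)) :
    LinearIndependent ℝ fun i j => (v i j : ℝ) :=
  LinearIndependent.of_comp (latticeMatrix ξ₁ ξ₂).mulVecLin h

theorem exists_minkowski_vectors (q : ℝ) : ∃ v : Fin 3 → Fin 3 → ℤ, ∃ n₀ n₁ n₂ : ℝ,
    LinearIndependent ℝ (fun i => latticePoint ξ₁ ξ₂ (v i)) ∧ (primal ξ₁ ξ₂).N q (v 0) ≤ n₀ ∧
    (primal ξ₁ ξ₂).N q (v 1) ≤ n₁ ∧ (primal ξ₁ ξ₂).N q (v 2) ≤ n₂ ∧ n₀ ≤ n₁ ∧ n₁ ≤ n₂ ∧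
    n₀ * n₁ * n₂ ≤ 27 ∧ ∀ w ≠ 0, n₀ ≤ 2 * (primal ξ₁ ξ₂).N q w := by
  set d : Matrix (Fin 3) (Fin 3) ℝ :=
    Matrix.diagonal ![Real.exp (-2 * q), Real.exp q, Real.exp q] with hd
  set F : (Fin 3 → ℤ) → EuclideanSpace ℝ (Fin 3) := fun w =>
    WithLp.toLp 2 (d.mulVec (latticePoint ξ₁ ξ₂ w)) with hF
  have hF0 : ∀ w, ‖F w 0‖ = Real.exp (-2 * q) * (primal ξ₁ ξ₂).f w := fun w => by
    simp [hF, hd, Matrix.mulVec_diagonal, latticePoint_eq, primal_f]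
  have hF1 : ∀ w, ‖F w 1‖ = Real.exp q * |ξ₁ * w 0 - w 1| := fun w => by
    simp [hF, hd, Matrix.mulVec_diagonal, latticePoint_eq]
  have hF2 : ∀ w, ‖F w 2‖ = Real.exp q * |ξ₂ * w 0 - w 2| := fun w => by
    simp [hF, hd, Matrix.mulVec_diagonal, latticePoint_eq]
  have hNF : ∀ w, (primal ξ₁ ξ₂).N q w = max ‖F w 0‖ (max ‖F w 1‖ ‖F w 2‖) := fun w => by
    rw [N, primal_g, mul_max_of_nonneg _ _ (Real.exp_pos q).le, hF0, hF1, hF2]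
  have hN : ∀ w, (primal ξ₁ ξ₂).N q w ≤ ‖F w‖ := fun w => by
    rw [hNF]
    exact max_le (PiLp.norm_apply_le _ _) (max_le (PiLp.norm_apply_le _ _) (PiLp.norm_apply_le _ _))
  have hN' : ∀ w, ‖F w‖ ≤ 2 * (primal ξ₁ ξ₂).N q w := fun w => by
    have h0 := N_nonneg (P := primal ξ₁ ξ₂) q w
    have h1 := (hNF w).ge
    rw [max_le_iff, max_le_iff] at h1
    refine le_of_sq_le_sq ?_ (by positivity)
    rw [EuclideanSpace.norm_sq_eq, Fin.sum_univ_three]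
    have := pow_le_pow_left₀ (norm_nonneg _) h1.1 2
    have := pow_le_pow_left₀ (norm_nonneg _) h1.2.1 2
    have := pow_le_pow_left₀ (norm_nonneg _) h1.2.2 2
    nlinarith
  obtain ⟨v, hv, hmin, h01, h12, hprod⟩ := exists_successive_minima_vectors
    (d * latticeMatrix ξ₁ ξ₂) (by
      rw [Matrix.det_mul, hd, Matrix.det_diagonal, Fin.prod_univ_three]
      simp only [Matrix.cons_val, latticeMatrix, Matrix.det_fin_three, ← Real.exp_add]
      ring_nf
      simp) F (fun w => by
      rw [hF, ← Matrix.mulVec_mulVec]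
      rfl) (fun C => by
      refine (primal_finite ξ₁ ξ₂ (max (Real.exp (2 * q) * C) (Real.exp (-q) * C))).subset
        fun w hw => ?_
      have := N_le_iff.1 ((hN w).trans hw)
      exact ⟨le_max_of_le_left this.1, le_max_of_le_right this.2⟩)
  refine ⟨v, ‖F (v 0)‖, ‖F (v 1)‖, ‖F (v 2)‖, ?_, hN _, hN _, hN _, h01, h12, hprod,
    fun w hw => (hmin w hw).trans (hN' w)⟩
  exact LinearIndependent.of_comp
    ((WithLp.linearEquiv 2 ℝ (Fin 3 → ℝ)).symm.toLinearMap ∘ₗ d.mulVecLin) hv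

theorem crossProduct_ne_zero_of_cast {v : Fin 3 → Fin 3 → ℤ}
    (hv : LinearIndependent ℝ fun i j => (v i j : ℝ)) : crossProduct (v 0) (v 1) ≠ 0 := by
  intro h
  have h1 : LinearIndependent ℝ ![fun j => (v 0 j : ℝ), fun j => (v 1 j : ℝ)] := by
    have := hv.comp ![0, 1] (by decide)
    convert this using 1
    ext i j
    fin_cases i <;> rfl
  refine crossProduct_ne_zero_iff_linearIndependent.2 h1 ?_
  rw [cross_apply] at h ⊢
  ext i
  have := congrArg (Int.cast : ℤ → ℝ) (congrFun h i)
  fin_cases i <;> simpa using this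

/-- Minkowski's second theorem and its consequences for the dual lattice. -/
theorem exists_minkowski_dual (q : ℝ) : ∃ v : Fin 3 → Fin 3 → ℤ, ∃ n₂ : ℝ, ∃ y ≠ 0,
    LinearIndependent ℝ (fun i => latticePoint ξ₁ ξ₂ (v i)) ∧
    (∀ i, (primal ξ₁ ξ₂).N q (v i) ≤ n₂) ∧ (dual ξ₁ ξ₂).N (-q) y * n₂ ≤ 54 ∧
    (primal ξ₁ ξ₂).N q (v 0) ≤ 216 ∧ (dual ξ₁ ξ₂).N (-q) y ≤ 216 ∧
    (∀ w ≠ 0, (primal ξ₁ ξ₂).N q (v 0) ^ 2 ≤ 216 * (dual ξ₁ ξ₂).N (-q) w) ∧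
    (∀ w ≠ 0, (dual ξ₁ ξ₂).N (-q) y ^ 2 ≤ 216 * (primal ξ₁ ξ₂).N q w) := by
  obtain ⟨v, n₀, n₁, n₂, hv, h0, h1, h2, h01, h12, hprod, hmin⟩ := exists_minkowski_vectors ξ₁ ξ₂ q
  have hv' := linearIndependent_cast_of_latticePoint ξ₁ ξ₂ hv
  have e0 := N_nonneg (P := primal ξ₁ ξ₂) q (v 0)
  have e1 := N_nonneg (P := primal ξ₁ ξ₂) q (v 1)
  have hn0 := e0.trans h0
  have hn1 := hn0.trans h01
  have hn2 := hn1.trans h12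
  have hi : ∀ i, (primal ξ₁ ξ₂).N q (v i) ≤ n₂ := by
    intro i
    fin_cases i
    · exact h0.trans (h01.trans h12)
    · exact h1.trans h12
    · exact h2
  set y := crossProduct (v 0) (v 1)
  have hy := N_nonneg (P := dual ξ₁ ξ₂) (-q) y
  have hyn : (dual ξ₁ ξ₂).N (-q) y ≤ 2 * (n₀ * n₁) := by
    refine ((isWedge_primal_dual ξ₁ ξ₂).N_cross_le q (v 0) (v 1)).trans ?_
    gcongr
  have hn0' : n₀ ≤ 3 := by
    refine le_of_pow_le_pow_left₀ (n := 3) (by norm_num) (by norm_num) ?_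
    calc n₀ ^ 3 = n₀ * n₀ * n₀ := by ring
      _ ≤ n₀ * n₁ * n₂ := by
        have := h01.trans h12
        gcongr
      _ ≤ _ := by linarith
  have hn01 : n₀ * n₁ ≤ 9 := by
    refine le_of_pow_le_pow_left₀ (n := 3) (by norm_num) (by norm_num) ?_
    calc (n₀ * n₁) ^ 3 = (n₀ * n₁) ^ 2 * (n₀ * n₁) := by ring
      _ ≤ (n₀ * n₁) ^ 2 * (n₂ * n₂) := by
        have := h01.trans h12
        gcongr
      _ = (n₀ * n₁ * n₂) ^ 2 := by ring
      _ ≤ 27 ^ 2 := by gcongr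
      _ ≤ _ := by norm_num
  refine ⟨v, n₂, y, crossProduct_ne_zero_of_cast hv', hv, hi, ?_, ?_, ?_, ?_, ?_⟩
  · calc _ ≤ 2 * (n₀ * n₁) * n₂ := by gcongr
      _ ≤ 54 := by linarith
  · linarith
  · linarith
  · intro w hw
    have h3 := one_le_three_mul_N ξ₁ ξ₂ q hv' hi hw
    have hwN := N_nonneg (P := dual ξ₁ ξ₂) (-q) w
    calc (primal ξ₁ ξ₂).N q (v 0) ^ 2 ≤ n₀ ^ 2 := by gcongr
      _ ≤ n₀ ^ 2 * (3 * ((dual ξ₁ ξ₂).N (-q) w * n₂)) := le_mul_of_one_le_right (by positivity) h3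
      _ = 3 * (dual ξ₁ ξ₂).N (-q) w * (n₀ * n₀ * n₂) := by ring
      _ ≤ 3 * (dual ξ₁ ξ₂).N (-q) w * (n₀ * n₁ * n₂) := by gcongr
      _ ≤ 3 * (dual ξ₁ ξ₂).N (-q) w * 27 := by gcongr
      _ ≤ _ := by linarith
  · intro w hw
    calc (dual ξ₁ ξ₂).N (-q) y ^ 2 ≤ (2 * (n₀ * n₁)) ^ 2 := by gcongr
      _ = 4 * (n₀ * (n₀ * n₁ * n₁)) := by ring
      _ ≤ 4 * (n₀ * (n₀ * n₁ * n₂)) := by gcongr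
      _ ≤ 4 * (n₀ * 27) := by gcongr
      _ ≤ _ := by linarith [hmin w hw]

variable {ξ₁ ξ₂} in
theorem dualPair_primal_dual (hind : LinearIndependent ℚ ![(1 : ℝ), ξ₁, ξ₂]) :
    DualPair (primal ξ₁ ξ₂) (dual ξ₁ ξ₂) 216 where
  one_le := by norm_num
  wedge := isWedge_primal_dual ξ₁ ξ₂
  wedge' := isWedge_dual_primal ξ₁ ξ₂
  finite := primal_finite ξ₁ ξ₂
  finite' := dual_finite ξ₁ ξ₂
  transfer :=
    { bdd := fun q => by
        obtain ⟨v, n₂, y, hy, hv, -, -, h1, -⟩ := exists_minkowski_dual ξ₁ ξ₂ q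
        exact ⟨v 0, fun h => hv.ne_zero 0 (by simp [latticePoint_eq, h]), h1⟩
      sq := fun q y hy => by
        obtain ⟨v, n₂, -, -, hv, -, -, -, -, h1, -⟩ := exists_minkowski_dual ξ₁ ξ₂ q
        exact ⟨v 0, fun h => hv.ne_zero 0 (by simp [latticePoint_eq, h]), h1 y hy⟩ }
  transfer' :=
    { bdd := fun q => by
        obtain ⟨v, n₂, y, hy, -, -, -, -, h1, -⟩ := exists_minkowski_dual ξ₁ ξ₂ (-q)
        rw [neg_neg] at h1
        exact ⟨y, hy, h1⟩
      sq := fun q w hw => by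
        obtain ⟨v, n₂, y, hy, -, -, -, -, -, -, h1⟩ := exists_minkowski_dual ξ₁ ξ₂ (-q)
        rw [neg_neg] at h1
        exact ⟨y, hy, h1 w hw⟩ }
  g_pos := fun u hu => primal_g_pos hind hu
  f_pos' := fun u hu => dual_f_pos hind hu
  unit := ⟨![0, 1, 0], fun h => by simpa using congrFun h 1, by simp [primal_f], by simp [primal_g]⟩
  unit' := ⟨![1, 0, 0], fun h => by simpa using congrFun h 0, by simp [dual_g], by simp [dual_f]⟩
  f_or_g := fun u hu => primal_f_or_g ξ₁ ξ₂ hu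
  g_or_f' := fun u hu => dual_g_or_f ξ₁ ξ₂ hu
  g_int' := fun u hu => one_le_dual_g ξ₁ ξ₂ hu

theorem exists_isFirstMin {P : FormTriple} (hfin : ∀ C, {u | P.f u ≤ C ∧ P.g u ≤ C}.Finite)
    (hpos : ∀ u ≠ 0, 0 < P.f u ∨ 0 < P.g u) : ∃ L, IsFirstMin P L := by
  have key : ∀ q, ∃ l, (∃ u ≠ 0, P.N q u = Real.exp l) ∧ ∀ w ≠ 0, Real.exp l ≤ P.N q w := by
    intro q
    obtain ⟨v, hv, hmin⟩ := Set.exists_min_of_finite_sublevels (P.N q) (fun C => by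
      refine (hfin (max (Real.exp (2 * q) * C) (Real.exp (-q) * C))).subset fun w hw => ?_
      have := N_le_iff.1 hw
      exact ⟨le_max_of_le_left this.1, le_max_of_le_right this.2⟩) {w | w ≠ 0}
      ⟨fun _ => 1, fun h => one_ne_zero (congrFun h 0)⟩
    have h0 : 0 < P.N q v := by
      rcases hpos v hv with h | h
      · exact lt_max_of_lt_left (by positivity)
      · exact lt_max_of_lt_right (by positivity)
    refine ⟨Real.log (P.N q v), ⟨v, hv, (Real.exp_log h0).symm⟩, fun w hw => ?_⟩
    rw [Real.exp_log h0]
    exact hmin w hw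
  exact ⟨fun q => (key q).choose, fun q => (key q).choose_spec⟩

theorem latticePoint_mem_smul_box {l : ℝ} (hl : 0 < l) (q : ℝ) (w : Fin 3 → ℤ) :
    latticePoint ξ₁ ξ₂ w ∈ l • Box q ↔ (primal ξ₁ ξ₂).N q w ≤ l := by
  have h : ∀ a b : ℝ, |l⁻¹ * a| ≤ b ↔ |a| ≤ b * l := fun a b => by
    rw [abs_mul, abs_of_pos (inv_pos.2 hl), inv_mul_le_iff₀ hl, mul_comm]
  rw [Set.mem_smul_set_iff_inv_smul_mem₀ hl.ne', N_le_iff, primal_f, primal_g, max_le_iff,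
    latticePoint_eq]
  simp only [Box, Set.mem_ofPred_eq, Pi.smul_apply, smul_eq_mul, Matrix.cons_val, h]

theorem mem_latticeSet_iff (p : Fin 3 → ℝ) :
    p ∈ LatticeSet ξ₁ ξ₂ ↔ ∃ w, latticePoint ξ₁ ξ₂ w = p := by
  constructor
  · rintro ⟨x, y₁, y₂, h0, h1, h2⟩
    refine ⟨![x, y₁, y₂], ?_⟩
    rw [latticePoint_eq]
    ext i
    fin_cases i
    · simp [h0]
    · simp [h1]
    · simp [h2]
  · rintro ⟨w, rfl⟩
    exact ⟨w 0, w 1, w 2, by simp [latticePoint_eq], by simp [latticePoint_eq],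
      by simp [latticePoint_eq]⟩

theorem lambdaMin_eq (j : ℕ) (q : ℝ) : lambdaMin ξ₁ ξ₂ j q =
    sInf {l : ℝ | 0 < l ∧ ∃ v : Fin j → (Fin 3 → ℤ),
      LinearIndependent ℝ (fun i => latticePoint ξ₁ ξ₂ (v i)) ∧
        ∀ i, (primal ξ₁ ξ₂).N q (v i) ≤ l} := by
  unfold lambdaMin
  congr 1
  ext l
  refine and_congr_right fun hl => ⟨?_, ?_⟩
  · rintro ⟨v, hv, hmem⟩
    choose w hw using fun i => (mem_latticeSet_iff ξ₁ ξ₂ _).1 (hmem i).1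
    obtain rfl : (fun i => latticePoint ξ₁ ξ₂ (w i)) = v := funext hw
    exact ⟨w, hv, fun i => (latticePoint_mem_smul_box ξ₁ ξ₂ hl q _).1 (hmem i).2⟩
  · rintro ⟨w, hw, hN⟩
    exact ⟨_, hw, fun i => ⟨(mem_latticeSet_iff ξ₁ ξ₂ _).2 ⟨_, rfl⟩,
      (latticePoint_mem_smul_box ξ₁ ξ₂ hl q _).2 (hN i)⟩⟩

theorem latticePoint_ne_zero {w : Fin 3 → ℤ} (hw : w ≠ 0) : latticePoint ξ₁ ξ₂ w ≠ 0 := by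
  intro h
  rw [latticePoint_eq] at h
  have h0 := congrFun h 0
  have h1 := congrFun h 1
  have h2 := congrFun h 2
  simp only [Matrix.cons_val, Pi.zero_apply, Int.cast_eq_zero] at h0
  simp only [h0, Matrix.cons_val, Pi.zero_apply, Int.cast_zero, mul_zero, zero_sub, neg_eq_zero,
    Int.cast_eq_zero] at h1 h2
  refine hw (funext fun i => ?_)
  fin_cases i <;> assumption

theorem lmin_one_eq {L : ℝ → ℝ} (hL : IsFirstMin (primal ξ₁ ξ₂) L) (q : ℝ) :
    Lmin ξ₁ ξ₂ 1 q = L q := by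
  have h : IsLeast {l : ℝ | 0 < l ∧ ∃ v : Fin 1 → (Fin 3 → ℤ),
      LinearIndependent ℝ (fun i => latticePoint ξ₁ ξ₂ (v i)) ∧
        ∀ i, (primal ξ₁ ξ₂).N q (v i) ≤ l} (Real.exp (L q)) := by
    constructor
    · obtain ⟨u, hu, huL⟩ := (hL q).1
      exact ⟨Real.exp_pos _, fun _ => u,
        linearIndependent_unique_iff.2 (latticePoint_ne_zero ξ₁ ξ₂ hu), fun _ => huL.le⟩
    · rintro l ⟨-, v, hv, hN⟩
      exact ((hL q).2 _ fun h0 => hv.ne_zero 0 (by simp [latticePoint_eq, h0])).trans (hN 0)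
  rw [Lmin, lambdaMin_eq, h.csInf_eq, Real.log_exp]

/-- The last successive minimum is the inverse of the first dual one up to a constant. -/
theorem abs_lmin_three_add_le {M : ℝ → ℝ} (hM : IsFirstMin (dual ξ₁ ξ₂) M) (q : ℝ) :
    |Lmin ξ₁ ξ₂ 3 q + M (-q)| ≤ Real.log 54 := by
  obtain ⟨v, n₂, y, hy, hv, hvn, hyn, -⟩ := exists_minkowski_dual ξ₁ ξ₂ q
  have h1 := one_le_three_mul_N ξ₁ ξ₂ q (linearIndependent_cast_of_latticePoint ξ₁ ξ₂ hv) hvn hy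
  have hn₂ : 0 < n₂ := by
    by_contra! h
    have := mul_nonpos_of_nonneg_of_nonpos (N_nonneg (P := dual ξ₁ ξ₂) (-q) y) h
    linarith
  have hupper : lambdaMin ξ₁ ξ₂ 3 q ≤ n₂ := by
    rw [lambdaMin_eq]
    exact csInf_le ⟨0, fun l hl => hl.1.le⟩ ⟨hn₂, v, hv, hvn⟩
  obtain ⟨z, hz, hzM⟩ := (hM (-q)).1
  have hlower : 1 / (3 * Real.exp (M (-q))) ≤ lambdaMin ξ₁ ξ₂ 3 q := by
    rw [lambdaMin_eq]
    refine le_csInf ⟨n₂, hn₂, v, hv, hvn⟩ ?_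
    rintro l ⟨hl, w, hw, hwl⟩
    have h2 := one_le_three_mul_N ξ₁ ξ₂ q (linearIndependent_cast_of_latticePoint ξ₁ ξ₂ hw) hwl hz
    rw [hzM] at h2
    rw [div_le_iff₀ (by positivity)]
    linarith
  have hpos : 0 < lambdaMin ξ₁ ξ₂ 3 q := (by positivity : (0 : ℝ) < _).trans_le hlower
  have hexp : Real.exp (Lmin ξ₁ ξ₂ 3 q + M (-q)) = lambdaMin ξ₁ ξ₂ 3 q * Real.exp (M (-q)) := by
    rw [Real.exp_add, Lmin, Real.exp_log hpos]
  rw [abs_le, neg_le, ← Real.exp_le_exp, ← Real.exp_le_exp (y := Real.log 54), Real.exp_neg,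
    Real.exp_log (by norm_num), hexp]
  constructor
  · rw [div_le_iff₀ (by positivity)] at hlower
    rw [inv_le_comm₀ (by positivity) (by norm_num)]
    linarith
  · have := (hM (-q)).2 y hy
    calc _ ≤ n₂ * (dual ξ₁ ξ₂).N (-q) y := by gcongr
      _ ≤ 54 := by linarith

end FormTriple

theorem le_of_forall_small_of_continuous {F G : ℝ → ℝ} (hF : Continuous F) (hG : Continuous G)
    {δ : ℝ} (hδ : 0 < δ) (h : ∀ ε, 0 < ε → ε < δ → F ε ≤ G ε) : F 0 ≤ G 0 := by
  refine le_of_tendsto_of_tendsto (b := nhdsWithin 0 (Set.Ioi 0))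
    (hF.tendsto 0 |>.mono_left nhdsWithin_le_nhds) (hG.tendsto 0 |>.mono_left nhdsWithin_le_nhds) ?_
  filter_upwards [Ioo_mem_nhdsGT hδ] with ε hε
  exact h ε hε.1 hε.2

theorem linear_bounds_of_liminf_limsup {L : ℝ → ℝ} {c d : ℝ} (hc : ∀ᶠ q in atTop, c * q ≤ L q)
    (hd : ∀ᶠ q in atTop, L q ≤ d * q) {ε : ℝ} (hε : 0 < ε) :
    (∀ᶠ q in atTop, (liminf (fun q => L q / q) atTop - ε) * q ≤ L q) ∧
    (∃ᶠ q in atTop, L q ≤ (liminf (fun q => L q / q) atTop + ε) * q) ∧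
    (∀ᶠ q in atTop, L q ≤ (limsup (fun q => L q / q) atTop + ε) * q) ∧
    (∃ᶠ q in atTop, (limsup (fun q => L q / q) atTop - ε) * q ≤ L q) := by
  have hpos := eventually_gt_atTop (0 : ℝ)
  have hb : IsBoundedUnder (· ≥ ·) atTop (fun q => L q / q) := by
    refine ⟨c, eventually_map.2 ?_⟩
    filter_upwards [hc, hpos] with q h1 h2
    exact (le_div_iff₀ h2).2 h1
  have hb' : IsBoundedUnder (· ≤ ·) atTop (fun q => L q / q) := by
    refine ⟨d, eventually_map.2 ?_⟩
    filter_upwards [hd, hpos] with q h1 h2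
    exact (div_le_iff₀ h2).2 h1
  refine ⟨?_, ?_, ?_, ?_⟩
  · filter_upwards [eventually_lt_of_lt_liminf (sub_lt_self _ hε) hb, hpos] with q h1 h2
    exact ((lt_div_iff₀ h2).1 h1).le
  · refine ((frequently_lt_of_liminf_lt hb'.isCoboundedUnder_ge
      (lt_add_of_pos_right _ hε)).and_eventually hpos).mono fun q h => ?_
    exact ((div_lt_iff₀ h.2).1 h.1).le
  · filter_upwards [eventually_lt_of_limsup_lt (lt_add_of_pos_right _ hε) hb', hpos] with q h1 h2
    exact ((div_lt_iff₀ h2).1 h1).le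
  · refine ((frequently_lt_of_lt_limsup hb.isCoboundedUnder_le
      (sub_lt_self _ hε)).and_eventually hpos).mono fun q h => ?_
    exact ((lt_div_iff₀ h.2).1 h.1).le

theorem laurent_relations_of_local_extrema {L₁ L₃ : ℝ → ℝ} {C : ℝ}
    (h₁ : ∀ q, 0 ≤ q → -2 * q ≤ L₁ q) (h₁' : ∀ q, L₁ q ≤ C)
    (h₃ : ∀ q, -C ≤ L₃ q) (h₃' : ∀ q, 0 ≤ q → L₃ q ≤ q + C)
    (hmax : ∀ R, ∀ᶠ q in atTop, ∃ q₀ m, R ≤ q₀ ∧ 2 * m ≤ q₀ + C ∧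
      L₁ q * q₀ ≤ -m * q ∧ L₃ (q₀ - m) ≤ m + C)
    (hmax' : ∀ R, ∀ᶠ q in atTop, ∃ q₁ m, R ≤ q₁ ∧ -C ≤ m ∧ m * q ≤ (L₃ q + C) * q₁ ∧
      -m - C ≤ L₁ (q₁ + m))
    (hmin' : ∀ R, ∀ᶠ q in atTop, ∃ p q₁ m, R ≤ p ∧ p ≤ q₁ ∧
      (L₃ q - C) * p ≤ (m + 2 * (q₁ - p)) * q ∧ L₃ q₁ ≤ m + C ∧ L₁ p ≤ -2 * m - (q₁ - p) + C)
    (hmin : ∀ R, ∀ᶠ q in atTop, ∃ p q₀ m, R ≤ q₀ ∧ q₀ ≤ p ∧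
      -L₁ q * p ≤ (m + 2 * (p - q₀)) * q ∧ -m ≤ L₁ q₀ ∧ 2 * m + (p - q₀) - C ≤ L₃ p)
    {l s b h : ℝ} (hl : liminf (fun q => L₁ q / q) atTop = l)
    (hs : limsup (fun q => L₁ q / q) atTop = s) (hb : liminf (fun q => L₃ q / q) atTop = b)
    (hh : limsup (fun q => L₃ q / q) atTop = h) :
    (0 ≤ b ∧ b ≤ h ∧ h ≤ 1) ∧ b + b * s + s = 0 ∧ 2 * l + h ≤ -b * (3 + l + 2 * h) ∧
      2 * h + l ≥ -s * (3 + h + 2 * l) := by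
  have hpos := eventually_gt_atTop (0 : ℝ)
  have hlin : ∀ ε > 0, ∀ᶠ q : ℝ in atTop, C ≤ ε * q := fun ε hε =>
    (tendsto_id.const_mul_atTop hε).eventually_ge_atTop C
  have H₁ : ∀ ε > 0, (∀ᶠ q in atTop, (l - ε) * q ≤ L₁ q) ∧ (∃ᶠ q in atTop, L₁ q ≤ (l + ε) * q) ∧
      (∀ᶠ q in atTop, L₁ q ≤ (s + ε) * q) ∧ (∃ᶠ q in atTop, (s - ε) * q ≤ L₁ q) := by
    intro ε hε
    rw [← hl, ← hs]
    refine linear_bounds_of_liminf_limsup (c := -2) (d := 1) ?_ ?_ hε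
    · filter_upwards [hpos] with q hq using h₁ q hq.le
    · filter_upwards [hlin 1 one_pos] with q hq using (h₁' q).trans hq
  have H₃ : ∀ ε > 0, (∀ᶠ q in atTop, (b - ε) * q ≤ L₃ q) ∧ (∃ᶠ q in atTop, L₃ q ≤ (b + ε) * q) ∧
      (∀ᶠ q in atTop, L₃ q ≤ (h + ε) * q) ∧ (∃ᶠ q in atTop, (h - ε) * q ≤ L₃ q) := by
    intro ε hε
    rw [← hb, ← hh]
    refine linear_bounds_of_liminf_limsup (c := -1) (d := 2) ?_ ?_ hε
    · filter_upwards [hlin 1 one_pos] with q hq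
      linarith [h₃ q]
    · filter_upwards [hpos, hlin 1 one_pos] with q hq hq'
      linarith [h₃' q hq.le]
  clear hl hs hb hh
  have hb0 : 0 ≤ b := by
    refine le_of_forall_small_of_continuous (F := fun ε => -ε) (G := fun ε => b + ε)
      (by fun_prop) (by fun_prop) one_pos (fun ε hε _ => ?_)
        |>.trans_eq (by simp) |>.trans' (by simp)
    obtain ⟨q, ⟨h1, h2⟩, h3⟩ :=
      (((H₃ ε hε).2.1.and_eventually (hlin ε hε)).and_eventually hpos).exists
    have := h₃ q
    nlinarith
  have hbh : b ≤ h := by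
    have := le_of_forall_small_of_continuous (F := fun ε => b - ε) (G := fun ε => h + ε)
      (by fun_prop) (by fun_prop) one_pos (fun ε hε _ => by
        obtain ⟨q, ⟨h1, h2⟩, h3⟩ := (((H₃ ε hε).1.and (H₃ ε hε).2.2.1).and hpos).exists
        nlinarith)
    simpa using this
  have hh1 : h ≤ 1 := by
    have := le_of_forall_small_of_continuous (F := fun ε => h - ε) (G := fun ε => 1 + ε)
      (by fun_prop) (by fun_prop) one_pos (fun ε hε _ => by
        obtain ⟨q, ⟨h1, h2⟩, h3⟩ :=
          (((H₃ ε hε).2.2.2.and_eventually (hlin ε hε)).and_eventually hpos).exists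
        have := h₃' q h3.le
        nlinarith)
    simpa using this
  have hA : b ≤ (1 + b) * -s := by
    have := le_of_forall_small_of_continuous (F := fun ε => b - ε)
      (G := fun ε => (1 + b - ε) * (-s + ε) + ε) (by fun_prop) (by fun_prop) one_pos
      (fun ε hε hε1 => by
        obtain ⟨R, hR⟩ := (eventually_atTop.1 (((H₃ ε hε).1.and (hlin ε hε)).and hpos))
        obtain ⟨q, ⟨h1, h2⟩, h3⟩ := (((H₁ ε hε).2.2.2.and_eventually
          (hmax (max R (2 * R + C)))).and_eventually hpos).exists
        obtain ⟨q₀, m, hq₀, hm, hmq, hLm⟩ := h2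
        obtain ⟨⟨-, h5⟩, h6⟩ := hR q₀ ((le_max_left _ _).trans hq₀)
        have h7 : R ≤ q₀ - m := by
          have := (le_max_right _ _).trans hq₀
          linarith
        obtain ⟨⟨h8, -⟩, -⟩ := hR _ h7
        have hm' : m ≤ (-s + ε) * q₀ := by
          refine le_of_mul_le_mul_right ?_ h3
          nlinarith
        refine le_of_mul_le_mul_right ?_ h6
        have : 0 ≤ 1 + b - ε := by linarith
        nlinarith)
    simpa using this
  have hB : -s ≤ (1 + s) * b := by
    have key : ∀ ε, 0 < ε → ∃ μ, -ε ≤ μ ∧ μ ≤ b + 2 * ε ∧ -s - 2 * ε ≤ (1 + s + ε) * μ := by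
      intro ε hε
      obtain ⟨R, hR⟩ := (eventually_atTop.1 (((H₁ ε hε).2.2.1.and (hlin ε hε)).and hpos))
      obtain ⟨q, ⟨⟨h1, h2⟩, h3⟩, h4⟩ := ((((H₃ ε hε).2.1.and_eventually
        (hmax' (max R (R + C)))).and_eventually (hlin ε hε)).and_eventually hpos).exists
      obtain ⟨q₁, m, hq₁, hm, hmq, hLm⟩ := h2
      obtain ⟨⟨-, h5⟩, h6⟩ := hR q₁ ((le_max_left _ _).trans hq₁)
      have h7 : R ≤ q₁ + m := by
        have := (le_max_right _ _).trans hq₁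
        linarith
      obtain ⟨⟨h8, -⟩, -⟩ := hR _ h7
      refine ⟨m / q₁, ?_, ?_, ?_⟩
      · rw [le_div_iff₀ h6]
        linarith
      · rw [div_le_iff₀ h6]
        refine le_of_mul_le_mul_right ?_ h4
        nlinarith
      · rw [mul_div_assoc', le_div_iff₀ h6]
        nlinarith
    rcases le_or_gt (-1) s with hs1 | hs1
    · have := le_of_forall_small_of_continuous (F := fun ε => -s - 2 * ε)
        (G := fun ε => (1 + s + ε) * (b + 2 * ε)) (by fun_prop) (by fun_prop) one_pos
        (fun ε hε hε1 => by
          obtain ⟨μ, -, h2, h3⟩ := key ε hε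
          have : 0 ≤ 1 + s + ε := by linarith
          nlinarith)
      simpa using this
    · have := le_of_forall_small_of_continuous (F := fun ε => -s - 2 * ε)
        (G := fun ε => -(1 + s + ε) * ε) (by fun_prop) (by fun_prop) (δ := -1 - s) (by linarith)
        (fun ε hε hε1 => by
          obtain ⟨μ, h1, -, h3⟩ := key ε hε
          have : 0 ≤ -(1 + s + ε) := by linarith
          nlinarith)
      simp only [mul_zero, sub_zero] at this
      linarith
  have hs2 : -1 / 2 ≤ s := by nlinarith
  refine ⟨⟨hb0, hbh, hh1⟩, by linarith, ?_, ?_⟩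
  · have := le_of_forall_small_of_continuous (F := fun ε => (2 + (b - 2 * ε)) * (l - 2 * ε))
      (G := fun ε => -(1 + 2 * (b - 2 * ε)) * (h - 2 * ε) - 3 * (b - 2 * ε)) (by fun_prop)
      (by fun_prop) (δ := 1 / 4) (by norm_num) (fun ε hε hε1 => by
        obtain ⟨R, hR⟩ := (eventually_atTop.1
          ((((H₃ ε hε).1.and (H₁ ε hε).1).and (hlin ε hε)).and hpos))
        obtain ⟨q, ⟨⟨h1, h2⟩, h3⟩, h4⟩ := ((((H₃ ε hε).2.2.2.and_eventually
          (hmin' R)).and_eventually (hlin ε hε)).and_eventually hpos).exists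
        obtain ⟨p, q₁, m, hp, hpq, hk, h5, h6⟩ := h2
        obtain ⟨⟨⟨-, h7⟩, h8⟩, h9⟩ := hR p hp
        obtain ⟨⟨⟨h10, -⟩, h11⟩, -⟩ := hR q₁ (hp.trans hpq)
        have hk' : (h - 2 * ε) * p ≤ m + 2 * (q₁ - p) := by
          refine le_of_mul_le_mul_right ?_ h4
          nlinarith
        have hm : (b - 2 * ε) * q₁ ≤ m := by linarith
        have hlp : (l - 2 * ε) * p ≤ -2 * m - (q₁ - p) := by linarith
        refine le_of_mul_le_mul_right ?_ h9
        have e1 : 0 ≤ 2 + (b - 2 * ε) := by linarith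
        have e2 : 0 ≤ 1 + 2 * (b - 2 * ε) := by linarith
        nlinarith [mul_le_mul_of_nonneg_left hlp e1, mul_le_mul_of_nonneg_left hk' e2])
    simp only [mul_zero, sub_zero] at this
    linarith
  · have := le_of_forall_small_of_continuous
      (F := fun ε => (1 + 2 * (s + ε)) * -(l + ε) - 3 * (s + ε))
      (G := fun ε => (2 + (s + ε)) * (h + 2 * ε)) (by fun_prop)
      (by fun_prop) one_pos (fun ε hε hε1 => by
        obtain ⟨R, hR⟩ := (eventually_atTop.1
          ((((H₃ ε hε).2.2.1.and (H₁ ε hε).2.2.1).and (hlin ε hε)).and hpos))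
        obtain ⟨q, ⟨h1, h2⟩, h4⟩ := (((H₁ ε hε).2.1.and_eventually
          (hmin R)).and_eventually hpos).exists
        obtain ⟨p, q₀, m, hq₀, hpq, hk, h5, h6⟩ := h2
        obtain ⟨⟨⟨-, h7⟩, -⟩, h9⟩ := hR q₀ hq₀
        obtain ⟨⟨⟨h10, -⟩, h11⟩, h12⟩ := hR p (hq₀.trans hpq)
        have hk' : -(l + ε) * p ≤ m + 2 * (p - q₀) := by
          refine le_of_mul_le_mul_right ?_ h4
          nlinarith
        have hm : -(s + ε) * q₀ ≤ m := by linarith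
        have hlp : 2 * m + (p - q₀) ≤ (h + 2 * ε) * p := by linarith
        refine le_of_mul_le_mul_right ?_ h12
        have e1 : 0 ≤ 2 + (s + ε) := by linarith
        have e2 : 0 ≤ 1 + 2 * (s + ε) := by linarith
        nlinarith [mul_le_mul_of_nonneg_left hlp e1, mul_le_mul_of_nonneg_left hk' e2])
    simp only [mul_zero, add_zero] at this
    linarith

/-- Laurent's relations: if `{1, ξ₁, ξ₂}` is linearly independent over `ℚ` then
`0 ≤ φ̲₃ ≤ φ̄₃ ≤ 1`, `φ̲₃ + φ̲₃·φ̄₁ + φ̄₁ = 0`,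
`2φ̲₁ + φ̄₃ ≤ -φ̲₃(3 + φ̲₁ + 2φ̄₃)` and `2φ̄₃ + φ̲₁ ≥ -φ̄₁(3 + φ̄₃ + 2φ̲₁)`. -/
theorem laurent_relations
    (ξ₁ ξ₂ : ℝ) (hind : LinearIndependent ℚ ![(1 : ℝ), ξ₁, ξ₂]) :
    (0 ≤ phiLow ξ₁ ξ₂ 3 ∧ phiLow ξ₁ ξ₂ 3 ≤ phiUp ξ₁ ξ₂ 3 ∧ phiUp ξ₁ ξ₂ 3 ≤ 1) ∧
    phiLow ξ₁ ξ₂ 3 + phiLow ξ₁ ξ₂ 3 * phiUp ξ₁ ξ₂ 1 + phiUp ξ₁ ξ₂ 1 = 0 ∧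
    2 * phiLow ξ₁ ξ₂ 1 + phiUp ξ₁ ξ₂ 3 ≤
      -phiLow ξ₁ ξ₂ 3 * (3 + phiLow ξ₁ ξ₂ 1 + 2 * phiUp ξ₁ ξ₂ 3) ∧
    2 * phiUp ξ₁ ξ₂ 3 + phiLow ξ₁ ξ₂ 1 ≥
      -phiUp ξ₁ ξ₂ 1 * (3 + phiUp ξ₁ ξ₂ 3 + 2 * phiLow ξ₁ ξ₂ 1) := by
  have hD := FormTriple.dualPair_primal_dual hind
  obtain ⟨L, hL⟩ := FormTriple.exists_isFirstMin hD.finite fun u hu => Or.inr (hD.g_pos u hu)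
  obtain ⟨M, hM⟩ := FormTriple.exists_isFirstMin hD.finite' fun u hu => Or.inl (hD.f_pos' u hu)
  have hL₁ : Lmin ξ₁ ξ₂ 1 = L := funext fun q => FormTriple.lmin_one_eq ξ₁ ξ₂ hL q
  have hM₃ := fun q => abs_le.1 (FormTriple.abs_lmin_three_add_le ξ₁ ξ₂ hM q)
  obtain ⟨K₁, hmax⟩ := hD.exists_primal_local_max hL hM
  obtain ⟨K₂, hmax'⟩ := hD.exists_dual_local_max hL hM
  have hL216 := hL.le_log hD.one_le hD.transfer
  have hM216 := hM.le_log hD.one_le hD.transfer'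
  have hK₁ := le_abs_self K₁
  have hK₂ := le_abs_self K₂
  have hK₁' := abs_nonneg K₁
  have hK₂' := abs_nonneg K₂
  have h216 : 0 ≤ Real.log 216 := Real.log_nonneg (by norm_num)
  have h54 : 0 ≤ Real.log 54 := Real.log_nonneg (by norm_num)
  have h2 : 0 ≤ Real.log 2 := Real.log_nonneg (by norm_num)
  obtain ⟨C, hC⟩ : ∃ C, C = |K₁| + |K₂| + Real.log 216 + Real.log 54 + Real.log 2 := ⟨_, rfl⟩
  have hneg : ∀ q, -M (-q) ≤ Lmin ξ₁ ξ₂ 3 q + C := fun q => by linarith [(hM₃ q).1]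
  have hneg' : ∀ q, Lmin ξ₁ ξ₂ 3 q - C ≤ -M (-q) := fun q => by linarith [(hM₃ q).2]
  refine laurent_relations_of_local_extrema (L₁ := Lmin ξ₁ ξ₂ 1) (L₃ := Lmin ξ₁ ξ₂ 3) (C := C)
    ?_ ?_ ?_ ?_ ?_ ?_ ?_ ?_ rfl rfl rfl rfl <;> try rw [hL₁]
  · exact fun q hq => hD.neg_two_mul_le hL hq
  · exact fun q => (hL216 q).trans (by linarith)
  · exact fun q => by linarith [(hM₃ q).1, hM216 (-q)]
  · exact fun q hq => by linarith [(hM₃ q).2, hD.neg_le hM hq]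
  · intro R
    filter_upwards [hmax R] with q ⟨q₀, m, e1, _, e2, e3, e4⟩
    exact ⟨q₀, m, e1, by linarith, e3, by linarith [(hM₃ (q₀ - m)).2]⟩
  · intro R
    filter_upwards [hmax' (max R 0)] with q ⟨q₁, m, e1, e2, e3, e4⟩
    refine ⟨q₁, m, (le_max_left _ _).trans e1, by linarith, e3.trans ?_, by linarith⟩
    exact mul_le_mul_of_nonneg_right (hneg q) ((le_max_right _ _).trans e1)
  · intro R
    filter_upwards [hD.exists_dual_minimal_pair hL hM (max R 0)]
      with q ⟨p, q₁, m, e1, e2, e3, e4, e5⟩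
    refine ⟨p, q₁, m, (le_max_left _ _).trans e1, e2, le_trans ?_ e3, ?_, by linarith⟩
    · exact mul_le_mul_of_nonneg_right (hneg' q) ((le_max_right _ _).trans e1)
    · linarith [hneg' q₁]
  · intro R
    filter_upwards [hD.exists_primal_minimal_pair hL hM R] with q ⟨p, q₀, m, e1, e2, e3, e4, e5⟩
    exact ⟨p, q₀, m, e1, e2, e3, e4, by linarith [(hM₃ p).1]⟩
end

section
/- For any real numbers ξ₁, ξ₂ with {1, ξ₁, ξ₂} linearly independent over ℚ, each of the functions L₁, L₂, L₃ is continuous on (0,∞) and piecewise linear with every linear piece having slope −2 or 1; in particular each L_j is differentiable outside a locally finite set of points, with derivative equal to −2 or 1 at every point of differentiability. -/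
open Filter Pointwise

/-- The exponent with which the `k`-th coordinate is weighted in the gauge of `Box q`. -/
def boxSlope : Fin 3 → ℝ := ![-2, 1, 1]

/-- The radii `l > 0` for which `l • Box q` contains `j` linearly independent lattice points. -/
def admissibleRadii (ξ₁ ξ₂ : ℝ) (j : ℕ) (q : ℝ) : Set ℝ :=
  {l : ℝ | 0 < l ∧ ∃ v : Fin j → (Fin 3 → ℝ), LinearIndependent ℝ v ∧
    ∀ i, v i ∈ LatticeSet ξ₁ ξ₂ ∧ v i ∈ l • Box q}

/-- `f` coincides near `q` with an affine function of slope `-2` or `1`. -/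
def IsLocallyAffineAt (f : ℝ → ℝ) (q : ℝ) : Prop :=
  ∃ s : ℝ, (s = -2 ∨ s = 1) ∧ ∀ᶠ x in nhds q, f x = f q + s * (x - q)

lemma boxSlope_eq_or (k : Fin 3) : boxSlope k = -2 ∨ boxSlope k = 1 := by
  fin_cases k <;> simp [boxSlope]

lemma abs_boxSlope_le (k : Fin 3) : |boxSlope k| ≤ 2 := by
  rcases boxSlope_eq_or k with h | h <;> rw [h] <;> norm_num

lemma boxSlope_mul_le (k : Fin 3) (t : ℝ) : boxSlope k * t ≤ 2 * |t| :=
  (le_abs_self _).trans <| by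
    rw [abs_mul]
    exact mul_le_mul_of_nonneg_right (abs_boxSlope_le k) (abs_nonneg t)

lemma mem_smul_box_iff {l : ℝ} (hl : 0 < l) (q : ℝ) (p : Fin 3 → ℝ) :
    p ∈ l • Box q ↔ ∀ k, |p k| * Real.exp (boxSlope k * q) ≤ l := by
  have key : ∀ k, |l⁻¹ * p k| ≤ Real.exp (-(boxSlope k * q)) ↔
      |p k| * Real.exp (boxSlope k * q) ≤ l := fun k => by
    rw [abs_mul, abs_of_pos (inv_pos.2 hl), inv_mul_le_iff₀ hl, Real.exp_neg,
      ← div_eq_mul_inv, le_div_iff₀ (Real.exp_pos _)]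
  rw [Set.mem_smul_set_iff_inv_smul_mem₀ hl.ne', Fin.forall_fin_succ, Fin.forall_fin_two,
    ← key, ← key, ← key]
  simp [Box, boxSlope]

lemma finite_latticeSet_abs_le (ξ₁ ξ₂ R : ℝ) :
    {p | p ∈ LatticeSet ξ₁ ξ₂ ∧ ∀ k, |p k| ≤ R}.Finite := by
  have hfin : ∀ B : ℝ, {n : ℤ | |(n : ℝ)| ≤ B}.Finite := fun B =>
    (Set.finite_Icc ⌈-B⌉ ⌊B⌋).subset fun n hn => by
      rw [Set.mem_ofPred_eq, abs_le] at hn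
      exact ⟨Int.ceil_le.2 hn.1, Int.le_floor.2 hn.2⟩
  refine (((hfin R).prod ((hfin (|ξ₁| * R + R)).prod (hfin (|ξ₂| * R + R)))).image
    fun t : ℤ × ℤ × ℤ =>
      (![(t.1 : ℝ), ξ₁ * t.1 - t.2.1, ξ₂ * t.1 - t.2.2] : Fin 3 → ℝ)).subset ?_
  rintro p ⟨⟨x, y₁, y₂, h0, h1, h2⟩, hp⟩
  have hx : |(x : ℝ)| ≤ R := h0 ▸ hp 0
  have hy : ∀ (ξ : ℝ) (y : ℤ), |ξ * x - y| ≤ R → |(y : ℝ)| ≤ |ξ| * R + R := fun ξ y h => by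
    calc |(y : ℝ)| = |ξ * x - (ξ * x - y)| := by ring_nf
      _ ≤ |ξ * x| + |ξ * x - y| := abs_sub _ _
      _ ≤ |ξ| * R + R := by
        rw [abs_mul]
        gcongr
  refine ⟨(x, y₁, y₂), ⟨hx, hy ξ₁ y₁ (h1 ▸ hp 1), hy ξ₂ y₂ (h2 ▸ hp 2)⟩, ?_⟩
  funext k
  fin_cases k <;> simp [h0, h1, h2]

lemma linearIndependent_latticeBasis (ξ₁ ξ₂ : ℝ) :
    LinearIndependent ℝ (![![1, ξ₁, ξ₂], ![0, 1, 0], ![0, 0, 1]] : Fin 3 → Fin 3 → ℝ) := by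
  rw [Fintype.linearIndependent_iff]
  intro g hg
  have h0 := congrFun hg 0
  have h1 := congrFun hg 1
  have h2 := congrFun hg 2
  simp [Fin.sum_univ_three] at h0 h1 h2
  simp [h0] at h1 h2
  intro i
  fin_cases i <;> simp [h0, h1, h2]

lemma latticeBasis_mem (ξ₁ ξ₂ : ℝ) (i : Fin 3) :
    (![![1, ξ₁, ξ₂], ![0, 1, 0], ![0, 0, 1]] : Fin 3 → Fin 3 → ℝ) i ∈ LatticeSet ξ₁ ξ₂ := by
  fin_cases i
  · exact ⟨1, 0, 0, by simp⟩
  · exact ⟨0, -1, 0, by simp⟩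
  · exact ⟨0, 0, -1, by simp⟩

lemma exists_mem_admissibleRadii (ξ₁ ξ₂ : ℝ) {j : ℕ} (hj : j ≤ 3) (r : ℝ) :
    ∃ C, ∀ q, |q| ≤ r → C ∈ admissibleRadii ξ₁ ξ₂ j q := by
  set M := 1 + |ξ₁| + |ξ₂|
  have hMpos : 0 < M := by positivity
  have hb : ∀ i k,
      |(![![1, ξ₁, ξ₂], ![0, 1, 0], ![0, 0, 1]] : Fin 3 → Fin 3 → ℝ) i k| ≤ M := by
    have h1 := abs_nonneg ξ₁
    have h2 := abs_nonneg ξ₂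
    intro i k
    fin_cases i <;> fin_cases k <;> simp <;> linarith
  refine ⟨M * Real.exp (2 * r), fun q hq => ⟨by positivity, _,
    (linearIndependent_latticeBasis ξ₁ ξ₂).comp _ (Fin.castLE_injective hj),
    fun i => ⟨latticeBasis_mem ξ₁ ξ₂ _, ?_⟩⟩⟩
  rw [mem_smul_box_iff (by positivity)]
  intro k
  have hk := boxSlope_mul_le k q
  exact mul_le_mul (hb _ k) (Real.exp_le_exp.2 (by linarith)) (Real.exp_pos _).le hMpos.le

/-- Every admissible radius dominates one which is the weighted absolute value of a coordinate
of a lattice point. -/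
lemma exists_coord_mem_admissibleRadii {ξ₁ ξ₂ : ℝ} {j : ℕ} (hj : 1 ≤ j) {q l : ℝ}
    (hl : l ∈ admissibleRadii ξ₁ ξ₂ j q) :
    ∃ p ∈ LatticeSet ξ₁ ξ₂, ∃ k, |p k| * Real.exp (boxSlope k * q) ∈ admissibleRadii ξ₁ ξ₂ j q ∧
      ∀ k', |p k'| * Real.exp (boxSlope k' * q) ≤ l := by
  obtain ⟨hl0, v, hv, hvl⟩ := hl
  have : Nonempty (Fin j) := ⟨⟨0, hj⟩⟩
  obtain ⟨⟨i, k⟩, hmax⟩ := Finite.exists_max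
    fun t : Fin j × Fin 3 => |v t.1 t.2| * Real.exp (boxSlope t.2 * q)
  have hpos : 0 < |v i k| * Real.exp (boxSlope k * q) := by
    obtain ⟨k', hk'⟩ := Function.ne_iff.1 (hv.ne_zero i)
    exact (mul_pos (abs_pos.2 hk') (Real.exp_pos _)).trans_le (hmax (i, k'))
  exact ⟨v i, (hvl i).1, k, ⟨hpos, v, hv, fun i' =>
    ⟨(hvl i').1, (mem_smul_box_iff hpos _ _).2 fun k' => hmax (i', k')⟩⟩,
    (mem_smul_box_iff hl0 _ _).1 (hvl i).2⟩

/-- On bounded sets of parameters the successive minima are attained, and their values are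
weighted absolute values of coordinates of finitely many lattice points. -/
lemma exists_finite_isLeast_lambdaMin (ξ₁ ξ₂ : ℝ) {j : ℕ} (hj : 1 ≤ j) (hj' : j ≤ 3) (r : ℝ) :
    ∃ P : Set (Fin 3 → ℝ), P.Finite ∧ ∀ q, |q| ≤ r →
      IsLeast (admissibleRadii ξ₁ ξ₂ j q) (lambdaMin ξ₁ ξ₂ j q) ∧
      ∃ p ∈ P, ∃ k, lambdaMin ξ₁ ξ₂ j q = |p k| * Real.exp (boxSlope k * q) := by
  obtain ⟨C, hC⟩ := exists_mem_admissibleRadii ξ₁ ξ₂ hj' r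
  refine ⟨_, finite_latticeSet_abs_le ξ₁ ξ₂ (C * Real.exp (2 * r)), fun q hq => ?_⟩
  set P := {p | p ∈ LatticeSet ξ₁ ξ₂ ∧ ∀ k, |p k| ≤ C * Real.exp (2 * r)}
  have hPfin : P.Finite := finite_latticeSet_abs_le _ _ _
  set V := {m ∈ admissibleRadii ξ₁ ξ₂ j q |
    ∃ p ∈ P, ∃ k, m = |p k| * Real.exp (boxSlope k * q)}
  have hVfin : V.Finite := by
    refine ((hPfin.prod (Set.finite_univ (α := Fin 3))).image
      fun t => |t.1 t.2| * Real.exp (boxSlope t.2 * q)).subset ?_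
    rintro m ⟨-, p, hp, k, rfl⟩
    exact ⟨(p, k), ⟨hp, trivial⟩, rfl⟩
  have hlow : ∀ l ∈ admissibleRadii ξ₁ ξ₂ j q, l ≤ C → ∃ m ∈ V, m ≤ l := by
    intro l hl hlC
    obtain ⟨p, hp, k, hpk, hle⟩ := exists_coord_mem_admissibleRadii hj hl
    refine ⟨_, ⟨hpk, p, ⟨hp, fun k' => ?_⟩, k, rfl⟩, hle k⟩
    have h := (hle k').trans hlC
    rw [← le_div_iff₀ (Real.exp_pos _), div_eq_mul_inv, ← Real.exp_neg] at h
    refine h.trans (mul_le_mul_of_nonneg_left (Real.exp_le_exp.2 ?_) (hC q hq).1.le)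
    have hk := boxSlope_mul_le k' (-q)
    rw [abs_neg] at hk
    linarith
  obtain ⟨m₁, hm₁, hm₁C⟩ := hlow C (hC q hq) le_rfl
  obtain ⟨m, hm, hmin⟩ := hVfin.exists_minimalFor id V ⟨m₁, hm₁⟩
  have hmV : ∀ n ∈ V, m ≤ n := fun n hn => (le_total m n).elim id fun h => hmin hn h
  have hleast : IsLeast (admissibleRadii ξ₁ ξ₂ j q) m := by
    refine ⟨hm.1, fun l hl => ?_⟩
    rcases le_total l C with h | h
    · obtain ⟨n, hn, hnl⟩ := hlow l hl h
      exact (hmV n hn).trans hnl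
    · exact ((hmV m₁ hm₁).trans hm₁C).trans h
  have heq : lambdaMin ξ₁ ξ₂ j q = m := hleast.csInf_eq
  rw [heq]
  exact ⟨hleast, hm.2⟩

lemma isLeast_lambdaMin (ξ₁ ξ₂ : ℝ) {j : ℕ} (hj : 1 ≤ j) (hj' : j ≤ 3) (q : ℝ) :
    IsLeast (admissibleRadii ξ₁ ξ₂ j q) (lambdaMin ξ₁ ξ₂ j q) :=
  have ⟨_, _, h⟩ := exists_finite_isLeast_lambdaMin ξ₁ ξ₂ hj hj' |q|
  (h q le_rfl).1

lemma lambdaMin_pos (ξ₁ ξ₂ : ℝ) {j : ℕ} (hj : 1 ≤ j) (hj' : j ≤ 3) (q : ℝ) :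
    0 < lambdaMin ξ₁ ξ₂ j q :=
  (isLeast_lambdaMin ξ₁ ξ₂ hj hj' q).1.1

lemma lipschitzWith_Lmin (ξ₁ ξ₂ : ℝ) {j : ℕ} (hj : 1 ≤ j) (hj' : j ≤ 3) :
    LipschitzWith 2 (Lmin ξ₁ ξ₂ j) := by
  refine LipschitzWith.of_le_add_mul 2 fun x q => ?_
  have hpos := lambdaMin_pos ξ₁ ξ₂ hj hj'
  have hmul : lambdaMin ξ₁ ξ₂ j q * Real.exp (2 * |x - q|) ∈ admissibleRadii ξ₁ ξ₂ j x := by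
    obtain ⟨-, v, hv, hvl⟩ := (isLeast_lambdaMin ξ₁ ξ₂ hj hj' q).1
    have hpos' := mul_pos (hpos q) (Real.exp_pos (2 * |x - q|))
    refine ⟨hpos', v, hv, fun i => ⟨(hvl i).1, (mem_smul_box_iff hpos' _ _).2 fun k => ?_⟩⟩
    have hk := (mem_smul_box_iff (hpos q) _ _).1 (hvl i).2 k
    calc |v i k| * Real.exp (boxSlope k * x)
        = |v i k| * Real.exp (boxSlope k * q) * Real.exp (boxSlope k * (x - q)) := by
          rw [mul_assoc, ← Real.exp_add]
          ring_nf
      _ ≤ _ := mul_le_mul hk (Real.exp_le_exp.2 (boxSlope_mul_le k _)) (Real.exp_pos _).le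
          (hpos q).le
  have hlog := Real.log_le_log (hpos x) ((isLeast_lambdaMin ξ₁ ξ₂ hj hj' x).2 hmul)
  rwa [Real.log_mul (hpos q).ne' (Real.exp_pos _).ne', Real.log_exp] at hlog

/-- Near bounded sets of parameters, `L_j` takes its values among those of finitely many affine
functions of slope `-2` or `1`. -/
lemma exists_finite_affine_Lmin (ξ₁ ξ₂ : ℝ) {j : ℕ} (hj : 1 ≤ j) (hj' : j ≤ 3) (r : ℝ) :
    ∃ G : Set (ℝ × ℝ), G.Finite ∧ (∀ g ∈ G, g.1 = -2 ∨ g.1 = 1) ∧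
      ∀ q, |q| ≤ r → ∃ g ∈ G, Lmin ξ₁ ξ₂ j q = g.1 * q + g.2 := by
  obtain ⟨P, hP, h⟩ := exists_finite_isLeast_lambdaMin ξ₁ ξ₂ hj hj' r
  refine ⟨_, (hP.prod (Set.finite_univ (α := Fin 3))).image
    fun t => (boxSlope t.2, Real.log |t.1 t.2|), ?_, fun q hq => ?_⟩
  · rintro _ ⟨t, -, rfl⟩
    exact boxSlope_eq_or t.2
  · obtain ⟨-, p, hp, k, hpk⟩ := h q hq
    refine ⟨_, ⟨(p, k), ⟨hp, trivial⟩, rfl⟩, ?_⟩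
    have hne : |p k| ≠ 0 := fun h0 => by
      have := lambdaMin_pos ξ₁ ξ₂ hj hj' q
      rw [hpk, h0, zero_mul] at this
      exact this.false
    rw [Lmin, hpk, Real.log_mul hne (Real.exp_pos _).ne', Real.log_exp, add_comm]

lemma finite_affine_crossings {G : Set (ℝ × ℝ)} (hG : G.Finite) :
    {q : ℝ | ∃ g ∈ G, ∃ h ∈ G, g ≠ h ∧ g.1 * q + g.2 = h.1 * q + h.2}.Finite := by
  refine ((hG.prod hG).image
    fun t : (ℝ × ℝ) × (ℝ × ℝ) => (t.2.2 - t.1.2) / (t.1.1 - t.2.1)).subset ?_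
  rintro q ⟨g, hg, h, hh, hne, heq⟩
  refine ⟨(g, h), ⟨hg, hh⟩, ?_⟩
  have hs : g.1 - h.1 ≠ 0 := fun hs => hne <| by
    have hs' : g.1 = h.1 := sub_eq_zero.1 hs
    rw [hs'] at heq
    exact Prod.ext hs' (add_left_cancel heq)
  rw [div_eq_iff hs]
  linarith

/-- A continuous function which near `q` takes its values among those of finitely many affine
functions, pairwise distinct at `q`, coincides with one of them near `q`. -/
lemma isLocallyAffineAt_of_not_crossing {f : ℝ → ℝ} {q : ℝ} (hf : ContinuousAt f q)
    {G : Set (ℝ × ℝ)} (hG : G.Finite) (hslope : ∀ g ∈ G, g.1 = -2 ∨ g.1 = 1)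
    (hmem : ∀ᶠ x in nhds q, ∃ g ∈ G, f x = g.1 * x + g.2)
    (hq : ∀ g ∈ G, ∀ h ∈ G, g.1 * q + g.2 = h.1 * q + h.2 → g = h) :
    IsLocallyAffineAt f q := by
  obtain ⟨g, hg, hgq⟩ := hmem.self_of_nhds
  refine ⟨g.1, hslope g hg, ?_⟩
  have hne : ∀ᶠ x in nhds q, ∀ h ∈ G, h ≠ g → f x ≠ h.1 * x + h.2 := by
    rw [eventually_all_finite hG]
    intro h hh
    by_cases hgh : h = g
    · exact Eventually.of_forall fun x hx => absurd hgh hx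
    · have hcont : ContinuousAt (fun x : ℝ => h.1 * x + h.2) q := by fun_prop
      filter_upwards [(hf.sub hcont).eventually_ne <| sub_ne_zero.2
        fun he => hgh (hq h hh g hg (he.symm.trans hgq))]
        with x hx _ using sub_ne_zero.1 hx
  filter_upwards [hmem, hne] with x ⟨h, hh, hx⟩ hx'
  obtain rfl : h = g := by
    by_contra hgh
    exact hx' h hh hgh hx
  rw [hx, hgq]
  ring

lemma IsLocallyAffineAt.exists_hasDerivAt {f : ℝ → ℝ} {q : ℝ} (h : IsLocallyAffineAt f q) :
    ∃ s : ℝ, (s = -2 ∨ s = 1) ∧ (∀ᶠ x in nhds q, f x = f q + s * (x - q)) ∧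
      HasDerivAt f s q := by
  obtain ⟨s, hs, hfs⟩ := h
  refine ⟨s, hs, hfs, HasDerivAt.congr_of_eventuallyEq ?_ hfs⟩
  simpa using (((hasDerivAt_id q).sub_const q).const_mul s).const_add (f q)

lemma finite_not_isLocallyAffineAt_Lmin (ξ₁ ξ₂ : ℝ) {j : ℕ} (hj : 1 ≤ j) (hj' : j ≤ 3)
    {K : Set ℝ} (hK : IsCompact K) : {q ∈ K | ¬ IsLocallyAffineAt (Lmin ξ₁ ξ₂ j) q}.Finite := by
  obtain ⟨r, hr⟩ := hK.isBounded.exists_norm_le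
  obtain ⟨G, hG, hslope, hmem⟩ := exists_finite_affine_Lmin ξ₁ ξ₂ hj hj' (r + 1)
  refine (finite_affine_crossings hG).subset ?_
  rintro q ⟨hqK, hq⟩
  by_contra hcross
  refine hq (isLocallyAffineAt_of_not_crossing
    (lipschitzWith_Lmin ξ₁ ξ₂ hj hj').continuous.continuousAt hG hslope ?_
    fun g hg h hh he => by_contra fun hne => hcross ⟨g, hg, h, hh, hne, he⟩)
  have hlt : |q| < r + 1 := (hr q hqK).trans_lt (lt_add_one r)
  filter_upwards [continuous_abs.continuousAt.eventually_lt_const hlt] with x hx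
  exact hmem x hx.le

/-- If `{1, ξ₁, ξ₂}` is linearly independent over `ℚ`, each `L_j` is continuous on
`(0,∞)` and piecewise linear there, every linear piece having slope `-2` or `1`:
outside a locally finite set `T` of switch points, `L_j` coincides near each point
with an affine function of slope `-2` or `1`; in particular `L_j` is differentiable
there with derivative `-2` or `1`. -/
theorem L_continuous_piecewise_linear
    (ξ₁ ξ₂ : ℝ) (hind : LinearIndependent ℚ ![(1 : ℝ), ξ₁, ξ₂])
    (j : ℕ) (hj : j ∈ ({1, 2, 3} : Set ℕ)) :
    ContinuousOn (Lmin ξ₁ ξ₂ j) (Set.Ioi 0) ∧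
    ∃ T : Set ℝ, T ⊆ Set.Ioi 0 ∧ (∀ K : Set ℝ, IsCompact K → (T ∩ K).Finite) ∧
      ∀ q ∈ Set.Ioi (0 : ℝ) \ T, ∃ s : ℝ, (s = -2 ∨ s = 1) ∧
        (∀ᶠ x in nhds q, Lmin ξ₁ ξ₂ j x = Lmin ξ₁ ξ₂ j q + s * (x - q)) ∧
        HasDerivAt (Lmin ξ₁ ξ₂ j) s q := by
  have hj₁ : 1 ≤ j ∧ j ≤ 3 := by
    rcases hj with rfl | rfl | rfl <;> norm_num
  refine ⟨(lipschitzWith_Lmin ξ₁ ξ₂ hj₁.1 hj₁.2).continuous.continuousOn,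
    {q | 0 < q ∧ ¬ IsLocallyAffineAt (Lmin ξ₁ ξ₂ j) q}, fun q hq => hq.1, fun K hK => ?_,
    fun q hq => ?_⟩
  · exact (finite_not_isLocallyAffineAt_Lmin ξ₁ ξ₂ hj₁.1 hj₁.2 hK).subset
      fun q hq => ⟨hq.2, hq.1.2⟩
  · exact (not_not.1 fun h => hq.2 ⟨hq.1, h⟩ :
      IsLocallyAffineAt (Lmin ξ₁ ξ₂ j) q).exists_hasDerivAt
end
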